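/- arXiv:2603.22203 — 4 statements merged into one kernel-verified Lean document; each statement's English description precedes it below -/
import Mathlib

section
/- For every integer k ≥ 1 there exist constants C_k and c_k such that the following holds. Let Q ≥ 2, let S : Γ_Q → ℂ be any function, set 𝐒 := max_{a/q ∈ Γ_Q} |S(a/q)|, and define w_Q(n) := ∑_{a/q ∈ Γ_Q} S(a/q)·e(n·a/q). Then for every integer N ≥ c_k·Q^{10k}: (1/N)·∑_{n=1}^{N} |w_Q(n)|^{2k} ≤ C_k · 𝐒^{2k} · Q^{2k} · (log Q)^{4^k}. -/
/-- `e(t) = exp(2πit)`. -/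
noncomputable def expCirc (t : ℝ) : ℂ := Complex.exp (2 * Real.pi * Complex.I * t)

/-- The index set for `Γ_Q = {a/q : Q/2 < q ≤ Q, 0 ≤ a < q, gcd(a,q) = 1}`, as a finset of
pairs `(q, a)` (note `Q/2 < q ↔ (Q : ℝ)/2 < q` for natural division). -/
def gammaIndex (Q : ℕ) : Finset ((_ : ℕ) × ℕ) :=
  (Finset.Ioc (Q / 2) Q).sigma fun q => (Finset.range q).filter fun a => Nat.Coprime a q

/-- The weight `w_Q(n) = ∑_{a/q ∈ Γ_Q} S(a/q) e(n a/q)`. -/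
noncomputable def majorArcSlice (Q : ℕ) (S : ℕ → ℕ → ℂ) (n : ℤ) : ℂ :=
  ∑ p ∈ gammaIndex Q, S p.1 p.2 * expCirc ((n : ℝ) * p.2 / p.1)

/-- `𝐒_Q = max_{a/q ∈ Γ_Q} |S(a/q)|`. -/
noncomputable def majorArcSup (Q : ℕ) (S : ℕ → ℕ → ℂ) : ℝ :=
  ((gammaIndex Q).sup fun p => ‖S p.1 p.2‖₊ : NNReal)

lemma exists_prod_eq_of_dvd_prod {ι : Type*} (s : Finset ι) (g : ι → ℕ) (e : ℕ)
    (he : e ∣ ∏ j ∈ s, g j) : ∃ h : ι → ℕ, (∀ j ∈ s, h j ∣ g j) ∧ ∏ j ∈ s, h j = e := by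
  classical
  induction s using Finset.induction_on generalizing e with
  | empty => exact ⟨fun _ => 1, by simp, by simpa [eq_comm] using he⟩
  | insert a s ha ih =>
    rw [Finset.prod_insert ha] at he
    obtain ⟨x, y, hx, hy, rfl⟩ := exists_dvd_and_dvd_of_dvd_mul he
    obtain ⟨h, h1, h2⟩ := ih y hy
    refine ⟨Function.update h a x, ?_, ?_⟩
    · intro j hj
      by_cases hja : j = a
      · subst hja; simpa using hx
      · simpa [hja] using h1 j (Finset.mem_of_mem_insert_of_ne hj hja)
    · rw [Finset.prod_insert ha, Finset.prod_update_of_notMem ha, h2]; simp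

/-- The number of divisors of `n` that are at most `Q`. -/
def truncDivisorCount (Q n : ℕ) : ℕ := ((Finset.Icc 1 Q).filter fun d => d ∣ n).card

lemma card_mul_truncDivisorCount_le {ι : Type*} [Fintype ι] [DecidableEq ι] (Q n : ℕ) :
    ((Fintype.piFinset fun _ : ι => Finset.Icc 1 Q).filter fun g => ∏ j, g j ∣ n).card *
        truncDivisorCount Q n ≤
      ((Fintype.piFinset fun _ : Option (ι ⊕ ι) => Finset.Icc 1 Q).filter
        fun g => ∏ j, g j ∣ n).card := by
  rw [truncDivisorCount, ← Finset.card_product]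
  refine Finset.card_le_card_of_surjOn
    (fun g => (fun j => g (some (.inl j)) * g (some (.inr j)),
      g none * ∏ j, g (some (.inl j)))) ?_
  rintro ⟨g, d⟩ hgd
  simp only [Finset.coe_product, Finset.coe_filter, Set.mem_prod, Set.mem_ofPred_eq,
    Fintype.mem_piFinset, Finset.mem_Icc] at hgd
  obtain ⟨⟨hg, hgn⟩, ⟨hd1, hdQ⟩, hdn⟩ := hgd
  obtain ⟨h, hh, hprod⟩ := exists_prod_eq_of_dvd_prod Finset.univ g (Nat.gcd d (∏ j, g j))
    (Nat.gcd_dvd_right _ _)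
  have hh' : ∀ j, h j * (g j / h j) = g j := fun j => Nat.mul_div_cancel' (hh j (Finset.mem_univ j))
  have hd' : d / Nat.gcd d (∏ j, g j) * Nat.gcd d (∏ j, g j) = d :=
    Nat.div_mul_cancel (Nat.gcd_dvd_left _ _)
  have hpos : ∀ {a b c : ℕ}, a * b = c → 1 ≤ c → c ≤ Q →
      (1 ≤ a ∧ a ≤ Q) ∧ (1 ≤ b ∧ b ≤ Q) := by
    intro a b c habc h1 hQ
    subst habc
    have ha : 0 < a := Nat.pos_of_mul_pos_right h1
    have hb : 0 < b := Nat.pos_of_mul_pos_left h1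
    refine ⟨⟨ha, ?_⟩, hb, ?_⟩ <;> nlinarith
  refine ⟨fun o => o.elim (d / Nat.gcd d (∏ j, g j)) (Sum.elim h fun j => g j / h j), ?_, ?_⟩
  · simp only [Finset.coe_filter, Set.mem_ofPred_eq, Fintype.mem_piFinset, Finset.mem_Icc]
    refine ⟨?_, ?_⟩
    · rintro (_ | j | j)
      · exact (hpos hd' hd1 hdQ).1
      · exact (hpos (hh' j) (hg j).1 (hg j).2).1
      · exact (hpos (hh' j) (hg j).1 (hg j).2).2
    · rw [Fintype.prod_option, Fintype.prod_sum_type]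
      simp only [Option.elim, Sum.elim_inl, Sum.elim_inr]
      rw [← Finset.prod_mul_distrib, Finset.prod_congr rfl fun j _ => hh' j,
        Nat.div_mul_right_comm (Nat.gcd_dvd_left _ _)]
      exact Nat.lcm_dvd hdn hgn
  · simp only [Option.elim, Sum.elim_inl, Sum.elim_inr, hh', hprod, hd']

lemma exists_truncDivisorCount_pow_le (r : ℕ) :
    ∃ (ι : Type) (_ : Fintype ι) (_ : DecidableEq ι), Fintype.card ι + 1 = 2 ^ r ∧
      ∀ Q n : ℕ, truncDivisorCount Q n ^ r ≤
        ((Fintype.piFinset fun _ : ι => Finset.Icc 1 Q).filter fun g => ∏ j, g j ∣ n).card := by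
  induction r with
  | zero => exact ⟨Empty, inferInstance, inferInstance, by simp, fun Q n => by simp⟩
  | succ r ih =>
    obtain ⟨ι, _, _, hcard, h⟩ := ih
    refine ⟨Option (ι ⊕ ι), inferInstance, inferInstance, ?_, fun Q n => ?_⟩
    · simp only [Fintype.card_option, Fintype.card_sum]; rw [pow_succ]; omega
    · rw [pow_succ]
      exact (Nat.mul_le_mul_right _ (h Q n)).trans (card_mul_truncDivisorCount_le Q n)

lemma sum_truncDivisorCount_pow_le (r Q X : ℕ) :
    ∑ n ∈ Finset.Ioc 0 X, (truncDivisorCount Q n : ℝ) ^ r ≤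
      X * (1 + Real.log Q) ^ (2 ^ r - 1) := by
  obtain ⟨ι, _, _, hcard, h⟩ := exists_truncDivisorCount_pow_le r
  set P := Fintype.piFinset fun _ : ι => Finset.Icc 1 Q
  have hH : ∑ d ∈ Finset.Icc 1 Q, ((d : ℝ))⁻¹ ≤ 1 + Real.log Q := by
    have := harmonic_le_one_add_log Q
    rw [harmonic_eq_sum_Icc] at this
    simpa using this
  calc ∑ n ∈ Finset.Ioc 0 X, (truncDivisorCount Q n : ℝ) ^ r
      ≤ ∑ n ∈ Finset.Ioc 0 X, ((P.filter fun g => ∏ j, g j ∣ n).card : ℝ) := by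
        refine Finset.sum_le_sum fun n _ => ?_
        exact_mod_cast h Q n
    _ = ∑ g ∈ P, (((Finset.Ioc 0 X).filter fun n => ∏ j, g j ∣ n).card : ℝ) := by
        have := Finset.sum_card_bipartiteAbove_eq_sum_card_bipartiteBelow
          (s := Finset.Ioc 0 X) (t := P) (fun n g => ∏ j, g j ∣ n)
        exact_mod_cast this
    _ ≤ ∑ g ∈ P, (X : ℝ) * ∏ j, ((g j : ℝ))⁻¹ := by
        refine Finset.sum_le_sum fun g _ => ?_
        rw [Nat.Ioc_filter_dvd_card_eq_div]
        refine Nat.cast_div_le.trans_eq ?_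
        rw [div_eq_mul_inv, Nat.cast_prod, Finset.prod_inv_distrib]
    _ = X * (∑ d ∈ Finset.Icc 1 Q, ((d : ℝ))⁻¹) ^ Fintype.card ι := by
        have := Finset.prod_univ_sum (fun _ : ι => Finset.Icc 1 Q) fun _ d => ((d : ℝ))⁻¹
        rw [← Finset.mul_sum, ← this, Finset.prod_const, Finset.card_univ]
    _ ≤ X * (1 + Real.log Q) ^ (2 ^ r - 1) := by
        rw [← hcard, Nat.add_sub_cancel]
        gcongr

lemma expCirc_add (s t : ℝ) : expCirc (s + t) = expCirc s * expCirc t := by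
  rw [expCirc, expCirc, expCirc, ← Complex.exp_add]
  push_cast
  ring_nf

lemma norm_expCirc (t : ℝ) : ‖expCirc t‖ = 1 := by
  rw [expCirc, show 2 * Real.pi * Complex.I * t = ((2 * Real.pi * t : ℝ) : ℂ) * Complex.I by
    push_cast; ring]
  exact Complex.norm_exp_ofReal_mul_I _

lemma conj_expCirc (t : ℝ) : (starRingEnd ℂ) (expCirc t) = expCirc (-t) := by
  rw [expCirc, expCirc, ← Complex.exp_conj]
  simp [map_ofNat]

lemma expCirc_nat_mul (n : ℕ) (t : ℝ) : expCirc (n * t) = expCirc t ^ n := by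
  rw [expCirc, expCirc, ← Complex.exp_nat_mul]
  push_cast
  ring_nf

lemma expCirc_intCast (n : ℤ) : expCirc n = 1 := by
  rw [expCirc, Complex.exp_eq_one_iff]
  exact ⟨n, by push_cast; ring⟩

lemma expCirc_sum {ι : Type*} (s : Finset ι) (t : ι → ℝ) :
    expCirc (∑ i ∈ s, t i) = ∏ i ∈ s, expCirc (t i) := by
  simp_rw [expCirc, ← Complex.exp_sum]
  push_cast
  rw [Finset.mul_sum]

lemma norm_sum_expCirc_div_le (r : ℕ) (m : ℤ) :
    ‖∑ b ∈ Finset.range r, expCirc ((m : ℝ) * b / r)‖ ≤ if (r : ℤ) ∣ m then (r : ℝ) else 0 := by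
  split_ifs with h
  · refine (norm_sum_le _ _).trans ?_
    simp [norm_expCirc]
  · rcases Nat.eq_zero_or_pos r with rfl | hr
    · simp
    have hr' : (r : ℝ) ≠ 0 := by positivity
    have h1 : expCirc ((m : ℝ) / r) ≠ 1 := by
      intro h1
      rw [expCirc, Complex.exp_eq_one_iff] at h1
      obtain ⟨n, hn⟩ := h1
      apply h
      refine ⟨n, ?_⟩
      have h2 : ((((m : ℝ) / r : ℝ)) : ℂ) = ((n : ℝ) : ℂ) := by
        apply mul_left_cancel₀ Complex.two_pi_I_ne_zero
        rw [hn]; push_cast; ring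
      have h3 : (m : ℝ) / r = n := by exact_mod_cast h2
      rw [div_eq_iff hr'] at h3
      have : (m : ℝ) = ((r * n : ℤ) : ℝ) := by rw [h3]; push_cast; ring
      exact_mod_cast this
    have h2 : expCirc ((m : ℝ) / r) ^ r = 1 := by
      rw [← expCirc_nat_mul, mul_div_cancel₀ _ hr', expCirc_intCast]
    have h3 : ∀ b : ℕ, expCirc ((m : ℝ) * b / r) = expCirc ((m : ℝ) / r) ^ b := fun b => by
      rw [← expCirc_nat_mul]; ring_nf
    simp_rw [h3]
    rw [geom_sum_eq h1, h2]
    simp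

lemma sum_filter_coprime_eq (q : ℕ) (hq : q ≠ 0) (x : ℕ → ℂ) :
    ∑ a ∈ (Finset.range q).filter (fun a => Nat.Coprime a q), x a =
      ∑ d ∈ q.divisors, (ArithmeticFunction.moebius d : ℂ) *
        ∑ b ∈ Finset.range (q / d), x (d * b) := by
  have hmu : ∀ n : ℕ, ∑ d ∈ n.divisors, (ArithmeticFunction.moebius d : ℂ) =
      if n = 1 then 1 else 0 := fun n => by
    have h := congrArg (fun f : ArithmeticFunction ℤ => f n) ArithmeticFunction.moebius_mul_coe_zeta
    simp only [ArithmeticFunction.coe_mul_zeta_apply, ArithmeticFunction.one_apply] at h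
    exact_mod_cast congrArg (Int.cast : ℤ → ℂ) h
  have hinner : ∀ d ∈ q.divisors, ∑ b ∈ Finset.range (q / d), x (d * b) =
      ∑ a ∈ (Finset.range q).filter (fun a => d ∣ a), x a := fun d hd => by
    have hdq := Nat.dvd_of_mem_divisors hd
    have hd0 : 0 < d := Nat.pos_of_mem_divisors hd
    refine Finset.sum_bij (fun b _ => d * b) ?_ ?_ ?_ fun _ _ => rfl
    · intro b hb
      simp only [Finset.mem_filter, Finset.mem_range, dvd_mul_right, and_true] at hb ⊢
      calc d * b < d * (q / d) := by gcongr
        _ = q := Nat.mul_div_cancel' hdq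
    · intro b _ b' _ h
      exact Nat.eq_of_mul_eq_mul_left hd0 h
    · intro a ha
      simp only [Finset.mem_filter, Finset.mem_range] at ha
      obtain ⟨haq, b, rfl⟩ := ha
      refine ⟨b, ?_, rfl⟩
      rw [Finset.mem_range, Nat.lt_div_iff_mul_lt' hdq]
      exact haq
  refine Eq.trans ?_ (Finset.sum_congr rfl fun d hd => by rw [hinner d hd]).symm
  simp_rw [Finset.sum_filter, Finset.mul_sum]
  rw [Finset.sum_comm]
  refine Finset.sum_congr rfl fun a _ => ?_
  have : (if a.Coprime q then x a else 0) =
      (∑ d ∈ (Nat.gcd a q).divisors, (ArithmeticFunction.moebius d : ℂ)) * x a := by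
    rw [hmu]; simp [Nat.Coprime]
  rw [this, Finset.sum_mul]
  have hset : (Nat.gcd a q).divisors = q.divisors.filter (fun d => d ∣ a) := by
    ext d
    simp [Nat.mem_divisors, Nat.dvd_gcd_iff, hq]
    tauto
  rw [hset, Finset.sum_filter]
  exact Finset.sum_congr rfl fun d _ => by split_ifs <;> simp

/-- The divisor bound for Ramanujan's sum `c_q(m)`. -/
lemma norm_ramanujan_sum_le (q : ℕ) (hq : q ≠ 0) (m : ℤ) :
    ‖∑ a ∈ (Finset.range q).filter (fun a => Nat.Coprime a q), expCirc ((m : ℝ) * a / q)‖ ≤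
      ∑ d ∈ q.divisors, if (d : ℤ) ∣ m then (d : ℝ) else 0 := by
  rw [sum_filter_coprime_eq q hq,
    ← Nat.sum_div_divisors q fun d => if (d : ℤ) ∣ m then (d : ℝ) else 0]
  refine (norm_sum_le _ _).trans (Finset.sum_le_sum fun d hd => ?_)
  have hdq := Nat.dvd_of_mem_divisors hd
  have hd0 : (d : ℝ) ≠ 0 := by
    have := Nat.pos_of_mem_divisors hd
    positivity
  rw [norm_mul]
  have h1 : ‖((ArithmeticFunction.moebius d : ℤ) : ℂ)‖ ≤ 1 := by
    rw [Complex.norm_intCast]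
    exact_mod_cast ArithmeticFunction.abs_moebius_le_one
  have h2 : ∀ b : ℕ, (m : ℝ) * (d * b : ℕ) / q = (m : ℝ) * b / (q / d : ℕ) := fun b => by
    rw [Nat.cast_div hdq hd0, Nat.cast_mul]
    field_simp
  simp_rw [h2]
  calc _ ≤ 1 * _ := mul_le_mul_of_nonneg_right h1 (norm_nonneg _)
    _ ≤ _ := by rw [one_mul]; exact norm_sum_expCirc_div_le _ _

lemma norm_sum_gammaIndex_expCirc_le (Q : ℕ) (m : ℤ) :
    ‖∑ p ∈ gammaIndex Q, expCirc ((m : ℝ) * p.2 / p.1)‖ ≤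
      Q * truncDivisorCount Q m.natAbs := by
  rw [gammaIndex, Finset.sum_sigma]
  calc _ ≤ ∑ q ∈ Finset.Ioc (Q / 2) Q, ∑ d ∈ q.divisors, if (d : ℤ) ∣ m then (d : ℝ) else 0 := by
        refine (norm_sum_le _ _).trans (Finset.sum_le_sum fun q hq => ?_)
        exact norm_ramanujan_sum_le q (by simp at hq; omega) m
    _ ≤ ∑ q ∈ Finset.Ioc 0 Q, ∑ d ∈ q.divisors, if (d : ℤ) ∣ m then (d : ℝ) else 0 := by
        refine Finset.sum_le_sum_of_subset_of_nonneg
          (Finset.Ioc_subset_Ioc_left (Nat.zero_le _)) fun q _ _ => ?_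
        exact Finset.sum_nonneg fun d _ => by positivity
    _ = ∑ q ∈ Finset.Ioc 0 Q, ∑ d ∈ Finset.Icc 1 Q,
          if d ∣ q then (if (d : ℤ) ∣ m then (d : ℝ) else 0) else 0 := by
        refine Finset.sum_congr rfl fun q hq => ?_
        rw [← Finset.sum_filter (fun d => d ∣ q)]
        refine Finset.sum_congr ?_ fun _ _ => rfl
        ext d
        simp only [Finset.mem_Ioc] at hq
        simp only [Nat.mem_divisors, Finset.mem_filter, Finset.mem_Icc]
        constructor
        · rintro ⟨h, -⟩
          exact ⟨⟨Nat.pos_of_dvd_of_pos h hq.1, (Nat.le_of_dvd hq.1 h).trans hq.2⟩, h⟩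
        · rintro ⟨-, h⟩
          exact ⟨h, by omega⟩
    _ = ∑ d ∈ Finset.Icc 1 Q, if (d : ℤ) ∣ m then (((Q / d : ℕ) : ℝ) * d) else 0 := by
        rw [Finset.sum_comm]
        refine Finset.sum_congr rfl fun d _ => ?_
        rw [← Finset.sum_filter, Finset.sum_const, Nat.Ioc_filter_dvd_card_eq_div, nsmul_eq_mul]
        split_ifs <;> simp
    _ ≤ ∑ d ∈ Finset.Icc 1 Q, if (d : ℤ) ∣ m then (Q : ℝ) else 0 := by
        refine Finset.sum_le_sum fun d _ => ?_
        split_ifs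
        · exact_mod_cast Nat.div_mul_le_self Q d
        · exact le_rfl
    _ = Q * truncDivisorCount Q m.natAbs := by
        rw [← Finset.sum_filter, Finset.sum_const, nsmul_eq_mul, mul_comm, truncDivisorCount]
        simp_rw [Int.natCast_dvd]

lemma sum_sum_normSq_eq {ι : Type*} (s : Finset ι) (θ : ι → ℝ) (c : ι → ℂ) (M : ℕ) :
    ((∑ i ∈ Finset.range M, ∑ j ∈ Finset.range M,
      ‖∑ p ∈ s, c p * expCirc ((((i : ℤ) - (j : ℤ) : ℤ) : ℝ) * θ p)‖ ^ 2 : ℝ) : ℂ) =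
    ∑ p ∈ s, ∑ q ∈ s, c p * (starRingEnd ℂ) (c q) *
      ((‖∑ i ∈ Finset.range M, expCirc ((i : ℝ) * (θ p - θ q))‖ ^ 2 : ℝ) : ℂ) := by
  push_cast
  simp_rw [← Complex.mul_conj', map_sum, Finset.sum_mul_sum]
  simp_rw [Finset.mul_sum]
  rw [Finset.sum_congr rfl fun i _ => Finset.sum_comm, Finset.sum_comm]
  refine Finset.sum_congr rfl fun p _ => ?_
  rw [Finset.sum_congr rfl fun i _ => Finset.sum_comm, Finset.sum_comm]
  refine Finset.sum_congr rfl fun q _ => ?_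
  refine Finset.sum_congr rfl fun i _ => Finset.sum_congr rfl fun j _ => ?_
  rw [map_mul, conj_expCirc, conj_expCirc, mul_mul_mul_comm, ← expCirc_add, ← expCirc_add]
  congr 2
  ring

lemma sum_sum_norm_sq_le {ι : Type*} (s : Finset ι) (θ : ι → ℝ) (c : ι → ℂ) (B : ℝ)
    (hc : ∀ p ∈ s, ‖c p‖ ≤ B) (M : ℕ) :
    ∑ i ∈ Finset.range M, ∑ j ∈ Finset.range M,
      ‖∑ p ∈ s, c p * expCirc ((((i : ℤ) - (j : ℤ) : ℤ) : ℝ) * θ p)‖ ^ 2 ≤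
    B ^ 2 * ∑ i ∈ Finset.range M, ∑ j ∈ Finset.range M,
      ‖∑ p ∈ s, expCirc ((((i : ℤ) - (j : ℤ) : ℤ) : ℝ) * θ p)‖ ^ 2 := by
  have h1 := sum_sum_normSq_eq s θ (fun _ => 1) M
  simp only [one_mul, map_one] at h1
  have h2 : ∑ i ∈ Finset.range M, ∑ j ∈ Finset.range M,
      ‖∑ p ∈ s, expCirc ((((i : ℤ) - (j : ℤ) : ℤ) : ℝ) * θ p)‖ ^ 2 =
      ∑ p ∈ s, ∑ q ∈ s, ‖∑ i ∈ Finset.range M, expCirc ((i : ℝ) * (θ p - θ q))‖ ^ 2 := by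
    exact_mod_cast h1
  rw [h2, Finset.mul_sum]
  refine (Complex.norm_of_nonneg (by positivity)).symm.trans_le ?_
  rw [sum_sum_normSq_eq]
  refine (norm_sum_le _ _).trans (Finset.sum_le_sum fun p hp => ?_)
  rw [Finset.mul_sum]
  refine (norm_sum_le _ _).trans (Finset.sum_le_sum fun q hq => ?_)
  rw [norm_mul, norm_mul, RCLike.norm_conj, Complex.norm_of_nonneg (by positivity), sq B]
  have hB : 0 ≤ B := (norm_nonneg _).trans (hc p hp)
  gcongr
  · exact hc p hp
  · exact hc q hq

/-- Over differences of an interval, the even moments of an exponential sum are at most those of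
the sum with its coefficients replaced by an upper bound for their absolute values. -/
lemma sum_sum_norm_pow_le {ι : Type*} (s : Finset ι) (θ : ι → ℝ) (c : ι → ℂ) (B : ℝ)
    (hc : ∀ p ∈ s, ‖c p‖ ≤ B) (M k : ℕ) :
    ∑ i ∈ Finset.range M, ∑ j ∈ Finset.range M,
      ‖∑ p ∈ s, c p * expCirc ((((i : ℤ) - (j : ℤ) : ℤ) : ℝ) * θ p)‖ ^ (2 * k) ≤
    B ^ (2 * k) * ∑ i ∈ Finset.range M, ∑ j ∈ Finset.range M,
      ‖∑ p ∈ s, expCirc ((((i : ℤ) - (j : ℤ) : ℤ) : ℝ) * θ p)‖ ^ (2 * k) := by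
  have hexp : ∀ (b : ι → ℂ) (x : ℝ), (∑ p ∈ s, b p * expCirc (x * θ p)) ^ k =
      ∑ t ∈ Fintype.piFinset (fun _ : Fin k => s),
        (∏ l, b (t l)) * expCirc (x * ∑ l, θ (t l)) := fun b x => by
    have := Finset.prod_univ_sum (fun _ : Fin k => s) fun _ p => b p * expCirc (x * θ p)
    rw [Finset.prod_const, Finset.card_univ, Fintype.card_fin] at this
    rw [this]
    refine Finset.sum_congr rfl fun t _ => ?_
    rw [Finset.prod_mul_distrib, Finset.mul_sum, expCirc_sum]
  have hexp1 : ∀ x : ℝ, (∑ p ∈ s, expCirc (x * θ p)) ^ k =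
      ∑ t ∈ Fintype.piFinset (fun _ : Fin k => s), expCirc (x * ∑ l, θ (t l)) := fun x => by
    simpa using hexp (fun _ => 1) x
  have hpow : ∀ z : ℂ, ‖z‖ ^ (2 * k) = ‖z ^ k‖ ^ 2 := fun z => by
    rw [norm_pow, ← pow_mul, mul_comm]
  simp_rw [hpow, hexp, hexp1]
  rw [mul_comm 2 k, pow_mul]
  have key := sum_sum_norm_sq_le (Fintype.piFinset fun _ : Fin k => s) (fun t => ∑ l, θ (t l))
    (fun t => ∏ l, c (t l)) (B ^ k) ?_ M
  · exact key
  intro t ht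
  rw [norm_prod]
  refine (Finset.prod_le_prod (fun _ _ => norm_nonneg _)
    fun l _ => hc _ (Fintype.mem_piFinset.1 ht l)).trans_eq ?_
  simp

lemma mul_sum_Icc_le_sum_sum_sub (f : ℤ → ℝ) (hf : ∀ n, 0 ≤ f n) (N : ℕ) :
    N * ∑ n ∈ Finset.Icc 1 N, f n ≤
      ∑ i ∈ Finset.range (2 * N), ∑ j ∈ Finset.range (2 * N), f ((i : ℤ) - (j : ℤ)) := by
  rw [Finset.sum_comm]
  calc (N : ℝ) * ∑ n ∈ Finset.Icc 1 N, f n = ∑ j ∈ Finset.range N, ∑ n ∈ Finset.Icc 1 N, f n := by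
        simp
    _ ≤ ∑ j ∈ Finset.range N, ∑ i ∈ Finset.range (2 * N), f ((i : ℤ) - (j : ℤ)) := by
        refine Finset.sum_le_sum fun j hj => ?_
        rw [Finset.mem_range] at hj
        have : ∑ n ∈ Finset.Icc 1 N, f n =
            ∑ i ∈ (Finset.Icc 1 N).image (· + j), f ((i : ℤ) - (j : ℤ)) := by
          rw [Finset.sum_image (by intro a _ b _ h; simpa using h)]
          simp
        rw [this]
        refine Finset.sum_le_sum_of_subset_of_nonneg ?_ fun _ _ _ => hf _
        intro i hi
        simp only [Finset.mem_image, Finset.mem_Icc, Finset.mem_range] at hi ⊢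
        omega
    _ ≤ _ := Finset.sum_le_sum_of_subset_of_nonneg
        (Finset.range_subset_range.2 (by omega)) fun _ _ _ => Finset.sum_nonneg fun _ _ => hf _

lemma sum_sum_natAbs_sub_le (t : ℕ → ℝ) (ht : ∀ n, 0 ≤ t n) (M : ℕ) :
    ∑ i ∈ Finset.range M, ∑ j ∈ Finset.range M, t ((i : ℤ) - (j : ℤ)).natAbs ≤
      M * (t 0 + 2 * ∑ n ∈ Finset.Ioc 0 M, t n) := by
  rw [← nsmul_eq_mul]
  nth_rw 3 [← Finset.card_range M]
  refine Finset.sum_le_card_nsmul _ _ _ fun i hi => ?_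
  rw [Finset.mem_range] at hi
  have hle : ∀ s ⊆ Finset.range M, Set.InjOn (fun j : ℕ => ((i : ℤ) - (j : ℤ)).natAbs) s →
      (∀ j ∈ s, j ≠ i) →
      ∑ j ∈ s, t ((i : ℤ) - (j : ℤ)).natAbs ≤ ∑ n ∈ Finset.Ioc 0 M, t n := by
    intro s hs hinj hne
    rw [← Finset.sum_image (f := t) hinj]
    refine Finset.sum_le_sum_of_subset_of_nonneg ?_ fun _ _ _ => ht _
    intro n hn
    obtain ⟨j, hj, rfl⟩ := Finset.mem_image.1 hn
    have h1 := Finset.mem_range.1 (hs hj)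
    have h2 := hne j hj
    rw [Finset.mem_Ioc]
    omega
  have h1 := hle ((Finset.range M).filter (· < i)) (Finset.filter_subset _ _)
    (by intro a ha b hb h; simp at ha hb h; omega) (by intro j hj; simp at hj; omega)
  have h2 := hle (((Finset.range M).filter (¬ · < i)).erase i)
    ((Finset.erase_subset _ _).trans (Finset.filter_subset _ _))
    (by intro a ha b hb h; simp at ha hb h; omega) (by intro j hj; simp at hj; omega)
  rw [← Finset.sum_filter_add_sum_filter_not _ (· < i),
    ← Finset.add_sum_erase ((Finset.range M).filter (¬ · < i)) _ (a := i) (by simpa using hi)]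
  simp only [sub_self, Int.natAbs_zero]
  linarith

lemma norm_le_majorArcSup (Q : ℕ) (S : ℕ → ℕ → ℂ) (p : (_ : ℕ) × ℕ) (hp : p ∈ gammaIndex Q) :
    ‖S p.1 p.2‖ ≤ majorArcSup Q S := by
  have := Finset.le_sup (f := fun p : (_ : ℕ) × ℕ => ‖S p.1 p.2‖₊) hp
  exact_mod_cast this

lemma sum_norm_majorArcSlice_pow_le (k Q N : ℕ) (S : ℕ → ℕ → ℂ) :
    N * ∑ n ∈ Finset.Icc 1 N, ‖majorArcSlice Q S (n : ℤ)‖ ^ (2 * k) ≤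
      majorArcSup Q S ^ (2 * k) * (Q ^ (2 * k) * ((2 * N : ℕ) * (Q ^ (2 * k) +
        2 * ((2 * N : ℕ) * (1 + Real.log Q) ^ (4 ^ k - 1))))) := by
  have hS : 0 ≤ majorArcSup Q S := NNReal.coe_nonneg _
  have h0 : truncDivisorCount Q 0 = Q := by simp [truncDivisorCount]
  refine (mul_sum_Icc_le_sum_sum_sub (fun n => ‖majorArcSlice Q S n‖ ^ (2 * k))
    (fun n => by positivity) N).trans ?_
  simp_rw [majorArcSlice, mul_div_assoc]
  refine (sum_sum_norm_pow_le (gammaIndex Q) (fun p => (p.2 : ℝ) / p.1) (fun p => S p.1 p.2)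
    (majorArcSup Q S) (norm_le_majorArcSup Q S) (2 * N) k).trans ?_
  gcongr
  calc _ ≤ ∑ i ∈ Finset.range (2 * N), ∑ j ∈ Finset.range (2 * N),
        (Q : ℝ) ^ (2 * k) * (truncDivisorCount Q ((i : ℤ) - (j : ℤ)).natAbs : ℝ) ^ (2 * k) := by
        refine Finset.sum_le_sum fun i _ => Finset.sum_le_sum fun j _ => ?_
        rw [← mul_pow]
        gcongr
        simpa only [mul_div_assoc] using norm_sum_gammaIndex_expCirc_le Q ((i : ℤ) - (j : ℤ))
    _ ≤ _ := by
        simp_rw [← Finset.mul_sum]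
        gcongr
        refine (sum_sum_natAbs_sub_le (fun n => (truncDivisorCount Q n : ℝ) ^ (2 * k))
          (fun n => by positivity) (2 * N)).trans ?_
        rw [h0]
        gcongr
        have := sum_truncDivisorCount_pow_le (2 * k) Q (2 * N)
        rwa [pow_mul, show 2 ^ 2 = 4 by norm_num] at this

/-- **Moment estimates for major-arc weights.** For every `k ≥ 1` there are constants
`C_k, c_k` so that for all `Q ≥ 2`, all coefficients `S : Γ_Q → ℂ` with
`𝐒 = max_{a/q ∈ Γ_Q}|S(a/q)|`, and all `N ≥ c_k Q^{10k}`: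
`(1/N) ∑_{n=1}^N |w_Q(n)|^{2k} ≤ C_k 𝐒^{2k} Q^{2k} (log Q)^{4^k}`. -/
theorem majorArcSlice_moments (k : ℕ) (hk : 1 ≤ k) :
    ∃ C c : ℝ, ∀ Q : ℕ, 2 ≤ Q → ∀ S : ℕ → ℕ → ℂ,
    ∀ N : ℕ, c * (Q : ℝ) ^ (10 * k) ≤ (N : ℝ) →
    (N : ℝ)⁻¹ * ∑ n ∈ Finset.Icc 1 N, ‖majorArcSlice Q S (n : ℤ)‖ ^ (2 * k) ≤
      C * majorArcSup Q S ^ (2 * k) * (Q : ℝ) ^ (2 * k) * Real.log Q ^ (4 ^ k) := by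
  refine ⟨10 * 3 ^ (4 ^ k), 1, fun Q hQ S N hN => ?_⟩
  rw [one_mul] at hN
  have hQ1 : (1 : ℝ) ≤ Q := by exact_mod_cast (by omega : 1 ≤ Q)
  have hQN : (Q : ℝ) ^ (2 * k) ≤ N := (pow_le_pow_right₀ hQ1 (by omega)).trans hN
  have hN0 : (0 : ℝ) < N := (by positivity : (0 : ℝ) < (Q : ℝ) ^ (2 * k)).trans_le hQN
  have hS : 0 ≤ majorArcSup Q S := NNReal.coe_nonneg _
  have hlogQ : 1 / 2 ≤ Real.log Q :=
    (by linarith [Real.log_two_gt_d9] : (1 : ℝ) / 2 ≤ Real.log 2).trans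
      (Real.log_le_log two_pos (by exact_mod_cast hQ))
  set H := 1 + Real.log Q with hH
  have hH1 : 1 ≤ H := by linarith
  have hHpow : H ^ (4 ^ k - 1) ≤ (3 * Real.log Q) ^ (4 ^ k) :=
    (pow_le_pow_right₀ hH1 (Nat.sub_le _ _)).trans (by gcongr; linarith)
  have hHone : 1 ≤ H ^ (4 ^ k - 1) := one_le_pow₀ hH1
  have hbound := sum_norm_majorArcSlice_pow_le k Q N S
  push_cast at hbound
  rw [inv_mul_le_iff₀ hN0]
  refine le_of_mul_le_mul_left (hbound.trans ?_) hN0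
  calc majorArcSup Q S ^ (2 * k) * ((Q : ℝ) ^ (2 * k) * (2 * N * (Q ^ (2 * k) +
        2 * (2 * N * H ^ (4 ^ k - 1)))))
      ≤ majorArcSup Q S ^ (2 * k) * ((Q : ℝ) ^ (2 * k) * (2 * N * (N * H ^ (4 ^ k - 1) +
        2 * (2 * N * H ^ (4 ^ k - 1))))) := by
        gcongr
        exact hQN.trans (le_mul_of_one_le_right hN0.le hHone)
    _ = N * (N * (10 * majorArcSup Q S ^ (2 * k) * (Q : ℝ) ^ (2 * k) * H ^ (4 ^ k - 1))) := by ring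
    _ ≤ N * (N * (10 * majorArcSup Q S ^ (2 * k) * (Q : ℝ) ^ (2 * k) *
        (3 * Real.log Q) ^ (4 ^ k))) := by gcongr
    _ = _ := by rw [mul_pow]; ring
end

section
/- For every ε > 0 there exist δ > 0 and a constant C such that the following holds. Let Q ≥ 2, let S : Γ_Q → ℂ satisfy |S(a/q)| ≤ q^{δ−1} for every a/q ∈ Γ_Q, and define w_Q(n) := ∑_{a/q ∈ Γ_Q} S(a/q)·e(n·a/q). Then for every integer N ≥ Q^{100}: ‖w_Q‖_{U³([N])} ≤ C · Q^{ε − 3/52}. -/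
/-- The conjugation-difference operator `Δ_h f (x) = f(x) ⋅ conj (f (x+h))`. -/
noncomputable def gowersDiff (f : ℤ → ℂ) (h : ℤ) : ℤ → ℂ :=
  fun x => f x * (starRingEnd ℂ) (f (x + h))

/-- Iterated conjugation-difference `Δ_{h₁,…,h_s} f`. -/
noncomputable def gowersIterDiff : (s : ℕ) → (ℤ → ℂ) → (Fin s → ℤ) → (ℤ → ℂ)
  | 0, f, _ => f
  | (s + 1), f, h => gowersDiff (gowersIterDiff s f (fun i => h i.castSucc)) (h (Fin.last s))

/-- The Gowers box sum `‖f‖_{U^s(ℤ)}^{2^s}`. -/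
noncomputable def gowersSum (s : ℕ) (f : ℤ → ℂ) : ℂ :=
  ∑' p : (Fin s → ℤ) × ℤ, gowersIterDiff s f p.1 p.2

/-- The Gowers norm `‖f‖_{U^s(ℤ)}`. -/
noncomputable def gowersNorm (s : ℕ) (f : ℤ → ℂ) : ℝ :=
  (gowersSum s f).re ^ ((1 : ℝ) / 2 ^ s)

/-- Restriction of `f` to the integer interval `[a, b]` (extended by `0`). -/
def intervalCutoff (a b : ℤ) (f : ℤ → ℂ) : ℤ → ℂ :=
  fun n => if a ≤ n ∧ n ≤ b then f n else 0

/-- The normalized Gowers norm `‖f‖_{U^s([N])}` on `{1, …, N}`. -/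
noncomputable def gowersNormOn (s : ℕ) (N : ℕ) (f : ℤ → ℂ) : ℝ :=
  gowersNorm s (intervalCutoff 1 N f) / gowersNorm s (intervalCutoff 1 N (fun _ => 1))

open Finset in
lemma Circle.norm_sum_zpow_le {ζ : Circle} {D : ℕ} (hD : 0 < D) (hζ : ζ ^ D = 1) (h1 : ζ ≠ 1)
    (a b : ℤ) : ‖∑ x ∈ Icc a b, ((ζ ^ x : Circle) : ℂ)‖ ≤ D := by
  have hgeom (n : ℕ) : ‖∑ k ∈ range n, (ζ : ℂ) ^ k‖ ≤ D := by
    have h1' : (ζ : ℂ) - 1 ≠ 0 := fun h => h1 (Circle.ext (by simpa using sub_eq_zero.1 h))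
    have hmod : (ζ : ℂ) ^ n = (ζ : ℂ) ^ (n % D) := by
      have hζ' : (ζ : ℂ) ^ D = 1 := by
        rw [← Circle.coe_pow, hζ, Circle.coe_one]
      conv_lhs => rw [← Nat.div_add_mod n D, pow_add, pow_mul, hζ', one_pow, one_mul]
    have heq : ∑ k ∈ range n, (ζ : ℂ) ^ k = ∑ k ∈ range (n % D), (ζ : ℂ) ^ k := by
      apply mul_right_cancel₀ h1'
      rw [geom_sum_mul, geom_sum_mul, hmod]
    rw [heq]
    refine (norm_sum_le _ _).trans ?_
    simpa [Circle.norm_coe] using (Nat.mod_lt n hD).le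
  have hshift : ∑ x ∈ Icc a b, ((ζ ^ x : Circle) : ℂ) =
      (ζ ^ a : Circle) * ∑ k ∈ range (b + 1 - a).toNat, (ζ : ℂ) ^ k := by
    rw [mul_sum]
    refine sum_nbij' (fun x => (x - a).toNat) (fun k => a + k) ?_ ?_ ?_ ?_ ?_
    · intro x hx; simp at hx ⊢; omega
    · intro x hx; simp at hx ⊢; omega
    · intro x hx; simp at hx ⊢; omega
    · intro x hx; simp
    · intro x hx
      rw [← Circle.coe_pow, ← Circle.coe_mul, ← zpow_natCast, ← zpow_add]
      simp only [mem_Icc] at hx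
      congr 2
      omega
  rw [hshift, norm_mul, Circle.norm_coe, one_mul]
  exact hgeom _

open Finset in
lemma Circle.card_le_of_div_pow_eq_one {s : Finset Circle} {n : ℕ} (hn : 0 < n)
    (hs : ∀ x ∈ s, ∀ y ∈ s, (x / y) ^ n = 1) : s.card ≤ n := by
  classical
  rcases s.eq_empty_or_nonempty with rfl | ⟨y, hy⟩
  · simp
  calc s.card = (s.image fun x => ((x / y : Circle) : ℂ)).card := by
        refine (card_image_of_injective _ fun a b hab => ?_).symm
        exact div_left_injective (Circle.ext hab)
    _ ≤ (Polynomial.nthRoots n (1 : ℂ)).toFinset.card := by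
        refine card_le_card fun w hw => ?_
        obtain ⟨x, hx, rfl⟩ := mem_image.1 hw
        rw [Multiset.mem_toFinset, Polynomial.mem_nthRoots hn, ← Circle.coe_pow, hs x hx y hy,
          Circle.coe_one]
    _ ≤ n := (Multiset.toFinset_card_le _).trans (Polynomial.card_nthRoots n 1)

lemma exists_succ_pow_le_mul_two_pow (k : ℕ) : ∃ C : ℕ, 0 < C ∧ ∀ a, (a + 1) ^ k ≤ C * 2 ^ a := by
  have h := tendsto_pow_const_mul_const_pow_of_abs_lt_one k (r := (1 / 2 : ℝ)) (by norm_num [abs_of_pos])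
  obtain ⟨B, hB⟩ := h.bddAbove_range
  refine ⟨⌈2 * B⌉₊ + 1, by positivity, fun a => ?_⟩
  have h1 : ((a + 1 : ℕ) : ℝ) ^ k * (1 / 2) ^ (a + 1) ≤ B := hB ⟨a + 1, rfl⟩
  have h2 : ((a + 1 : ℕ) : ℝ) ^ k ≤ 2 * B * 2 ^ a := by
    have : ((a + 1 : ℕ) : ℝ) ^ k = 2 * (((a + 1 : ℕ) : ℝ) ^ k * (1 / 2) ^ (a + 1)) * 2 ^ a := by
      rw [pow_succ, one_div, inv_pow]; field_simp
    rw [this]; gcongr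
  have h3 : (2 * B : ℝ) ≤ (⌈2 * B⌉₊ + 1 : ℕ) := (Nat.le_ceil _).trans (by simp)
  have h4 : ((a + 1 : ℕ) : ℝ) ^ k ≤ (⌈2 * B⌉₊ + 1 : ℕ) * 2 ^ a := h2.trans (by gcongr)
  exact_mod_cast h4

/-- The divisor bound `τ(n) ≪ n ^ (1 / k)`. -/
lemma exists_card_divisors_pow_le (k : ℕ) :
    ∃ C : ℕ, 0 < C ∧ ∀ n, n ≠ 0 → n.divisors.card ^ k ≤ C * n := by
  obtain ⟨B, hB, hB'⟩ := exists_succ_pow_le_mul_two_pow k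
  set small : ℕ → Finset ℕ := fun n => n.primeFactors.filter (· < 2 ^ k) with hsmall
  have key (n : ℕ) : n ≠ 0 → n.divisors.card ^ k ≤ B ^ (small n).card * n := by
    induction n using Nat.recOnPosPrimePosCoprime with
    | zero => simp
    | one => simp [hsmall]
    | prime_pow p a hp ha =>
      intro _
      rw [Nat.divisors_prime_pow hp, Finset.card_map, Finset.card_range]
      simp only [hsmall, Nat.primeFactors_prime_pow ha.ne' hp, Finset.filter_singleton]
      split_ifs with h
      · simpa using (hB' a).trans (by gcongr; exact hp.two_le)
      · simp only [Finset.card_empty, pow_zero, one_mul]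
        calc (a + 1) ^ k ≤ (2 ^ a) ^ k := by gcongr; exact Nat.lt_two_pow_self
          _ = (2 ^ k) ^ a := by rw [← pow_mul, ← pow_mul, mul_comm]
          _ ≤ p ^ a := by gcongr; omega
    | coprime a b ha hb hab iha ihb =>
      intro _
      rw [hab.card_divisors_mul, mul_pow]
      have : small (a * b) = small a ∪ small b := by
        simp only [hsmall, hab.primeFactors_mul, Finset.filter_union]
      rw [this, Finset.card_union_of_disjoint
        (Finset.disjoint_filter_filter hab.disjoint_primeFactors), pow_add]
      calc _ ≤ (B ^ (small a).card * a) * (B ^ (small b).card * b) :=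
            Nat.mul_le_mul (iha (by omega)) (ihb (by omega))
        _ = _ := by ring
  refine ⟨B ^ 2 ^ k, by positivity, fun n hn => (key n hn).trans ?_⟩
  gcongr
  calc (small n).card ≤ (Finset.range (2 ^ k)).card := Finset.card_le_card fun p hp => by
        simpa using (Finset.mem_filter.1 hp).2
    _ = 2 ^ k := Finset.card_range _

open Finset in
lemma sum_gcd_le (Q : ℕ) {L : ℕ} (hL : L ≠ 0) :
    ∑ q ∈ Icc 1 Q, q.gcd L ≤ Q * L.divisors.card := by
  calc ∑ q ∈ Icc 1 Q, q.gcd L ≤ ∑ q ∈ Icc 1 Q, ∑ d ∈ L.divisors, if d ∣ q then d else 0 := by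
        refine sum_le_sum fun q _ => ?_
        have := single_le_sum (s := L.divisors) (f := fun d => if d ∣ q then d else 0)
          (fun _ _ => Nat.zero_le _) (Nat.mem_divisors.2 ⟨Nat.gcd_dvd_right q L, hL⟩)
        simpa [Nat.gcd_dvd_left] using this
    _ = ∑ d ∈ L.divisors, ∑ q ∈ Icc 1 Q, if d ∣ q then d else 0 := sum_comm
    _ ≤ ∑ d ∈ L.divisors, Q := by
        refine sum_le_sum fun d _ => ?_
        rw [← sum_filter, sum_const, smul_eq_mul]
        have : (Icc 1 Q).filter (d ∣ ·) = (Ioc 0 Q).filter (d ∣ ·) := rfl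
        rw [this, Nat.Ioc_filter_dvd_card_eq_div]
        exact Nat.div_mul_le_self Q d
    _ = _ := by rw [sum_const, smul_eq_mul, mul_comm]

lemma exists_pow_eq_one_of_four {G : Type*} [CommGroup G] {x₁ x₂ x₃ x₄ : G} {a b c d Q : ℕ}
    (h₁ : x₁ ^ a = 1) (h₂ : x₂ ^ b = 1) (h₃ : x₃ ^ c = 1) (h₄ : x₄ ^ d = 1)
    (ha : 1 ≤ a) (hb : 1 ≤ b) (hc : 1 ≤ c) (hd : 1 ≤ d)
    (ha' : a ≤ Q) (hb' : b ≤ Q) (hc' : c ≤ Q) (hd' : d ≤ Q) :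
    ∃ n, 0 < n ∧ n ≤ Q ^ 4 ∧ (x₁ / x₂ / (x₃ / x₄)) ^ n = 1 := by
  refine ⟨a * b * (c * d), by positivity, ?_, ?_⟩
  · calc a * b * (c * d) ≤ Q * Q * (Q * Q) := by gcongr
      _ = Q ^ 4 := by ring
  · have key {x : G} {m n : ℕ} (hx : x ^ m = 1) (h : m ∣ n) : x ^ n = 1 :=
      orderOf_dvd_iff_pow_eq_one.1 ((orderOf_dvd_of_pow_eq_one hx).trans h)
    simp only [div_pow]
    rw [key h₁ ⟨b * (c * d), by ring⟩, key h₂ ⟨a * (c * d), by ring⟩,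
      key h₃ ⟨a * b * d, by ring⟩, key h₄ ⟨a * b * c, by ring⟩]
    simp

open Finset in
lemma sum_mul_sum_mul_sum_mul_sum {ι R : Type*} [CommSemiring R] (s : Finset ι)
    (f₁ f₂ f₃ f₄ : ι → R) :
    (∑ i ∈ s, f₁ i) * (∑ i ∈ s, f₂ i) * ((∑ i ∈ s, f₃ i) * ∑ i ∈ s, f₄ i) =
      ∑ t ∈ (s ×ˢ s) ×ˢ (s ×ˢ s), f₁ t.1.1 * f₂ t.1.2 * (f₃ t.2.1 * f₄ t.2.2) := by
  rw [sum_product, sum_mul_sum s s f₁, sum_mul_sum s s f₃, ← sum_product', ← sum_product',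
    sum_mul_sum]

section GowersSum

open Finset

lemma gowersIterDiff_two (f : ℤ → ℂ) (h₁ h₂ x : ℤ) :
    gowersIterDiff 2 f ![h₁, h₂] x = f x * (starRingEnd ℂ) (f (x + h₁)) *
      (starRingEnd ℂ) (f (x + h₂) * (starRingEnd ℂ) (f (x + h₂ + h₁))) := rfl

lemma gowersIterDiff_three (f : ℤ → ℂ) (h₁ h₂ h₃ x : ℤ) :
    gowersIterDiff 3 f ![h₁, h₂, h₃] x = gowersIterDiff 2 f ![h₁, h₂] x *
      (starRingEnd ℂ) (gowersIterDiff 2 f ![h₁, h₂] (x + h₃)) := rfl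

lemma gowersSum_three {f : ℤ → ℂ} {N : ℕ} (hf : ∀ n, f n ≠ 0 → n ∈ Icc (1 : ℤ) N) :
    gowersSum 3 f = ((∑ h₁ ∈ Icc (-N : ℤ) N, ∑ h₂ ∈ Icc (-N : ℤ) N,
      ‖∑ x ∈ Icc (1 : ℤ) N, gowersIterDiff 2 f ![h₁, h₂] x‖ ^ 2 : ℝ) : ℂ) := by
  let e : (ℤ × ℤ) × (ℤ × ℤ) ≃ (Fin 3 → ℤ) × ℤ :=
    { toFun := fun s => (![s.1.1, s.1.2, s.2.2 - s.2.1], s.2.1)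
      invFun := fun p => ((p.1 0, p.1 1), (p.2, p.2 + p.1 2))
      left_inv := fun s => by simp
      right_inv := fun p => by
        refine Prod.ext ?_ rfl
        funext i
        fin_cases i <;> simp }
  have he (s) : gowersIterDiff 3 f (e s).1 (e s).2 = gowersIterDiff 2 f ![s.1.1, s.1.2] s.2.1 *
      (starRingEnd ℂ) (gowersIterDiff 2 f ![s.1.1, s.1.2] s.2.2) := by
    have := gowersIterDiff_three f s.1.1 s.1.2 (s.2.2 - s.2.1) s.2.1
    rwa [add_sub_cancel] at this
  rw [gowersSum, ← e.tsum_eq]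
  simp_rw [he]
  rw [tsum_eq_sum (s := (Icc (-N : ℤ) N ×ˢ Icc (-N : ℤ) N) ×ˢ (Icc (1 : ℤ) N ×ˢ Icc (1 : ℤ) N))]
  · rw [sum_product, sum_product]
    push_cast
    refine sum_congr rfl fun h₁ _ => sum_congr rfl fun h₂ _ => ?_
    rw [← Complex.mul_conj', map_sum, sum_mul_sum, ← sum_product']
  · rintro ⟨⟨h₁, h₂⟩, x, y⟩ hs
    by_contra hne
    simp only [gowersIterDiff_two, map_mul, mul_eq_zero, map_eq_zero, not_or] at hne
    obtain ⟨⟨⟨hx, hx1⟩, hx2, -⟩, ⟨hy, -⟩, -⟩ := hne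
    have hx := hf _ hx
    have hx1 := hf _ hx1
    have hx2 := hf _ hx2
    have hy := hf _ hy
    simp only [mem_product, mem_Icc] at hs hx hx1 hx2 hy
    omega

lemma intervalCutoff_support {f : ℤ → ℂ} {N : ℕ} (n : ℤ) (hn : intervalCutoff 1 N f n ≠ 0) :
    n ∈ Icc (1 : ℤ) N := by
  unfold intervalCutoff at hn
  rw [mem_Icc]
  by_contra h
  exact hn (if_neg h)

lemma sum_gowersIterDiff_intervalCutoff (f : ℤ → ℂ) (N : ℕ) (h₁ h₂ : ℤ) :
    ∃ a b : ℤ, b + 1 - a ≤ N ∧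
      ∑ x ∈ Icc (1 : ℤ) N, gowersIterDiff 2 (intervalCutoff 1 N f) ![h₁, h₂] x =
      ∑ x ∈ Icc a b, gowersIterDiff 2 f ![h₁, h₂] x := by
  refine ⟨max (max 1 (1 - h₁)) (max (1 - h₂) (1 - h₂ - h₁)),
    min (min N (N - h₁)) (min (N - h₂) (N - h₂ - h₁)), by omega, ?_⟩
  symm
  refine sum_subset_zero_on_sdiff (fun x hx => ?_) (fun x hx => ?_) (fun x hx => ?_)
  · simp only [mem_Icc] at hx ⊢; omega
  · rw [gowersIterDiff_two]
    simp only [mem_sdiff, mem_Icc, max_le_iff, le_min_iff] at hx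
    by_contra hne
    simp only [map_mul, mul_eq_zero, map_eq_zero, not_or] at hne
    obtain ⟨⟨h0, h1⟩, h2, h3⟩ := hne
    have h0 := intervalCutoff_support _ h0
    have h1 := intervalCutoff_support _ h1
    have h2 := intervalCutoff_support _ h2
    have h3 := intervalCutoff_support _ h3
    simp only [mem_Icc] at h0 h1 h2 h3
    omega
  · simp only [mem_Icc, max_le_iff, le_min_iff] at hx
    simp only [gowersIterDiff_two, intervalCutoff]
    rw [if_pos (by omega), if_pos (by omega), if_pos (by omega), if_pos (by omega)]

lemma gowersSum_three_one_ge (M N : ℕ) (hM : 4 * M ≤ N) :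
    (M : ℝ) ^ 4 ≤ (gowersSum 3 (intervalCutoff 1 N fun _ => 1)).re := by
  rw [gowersSum_three intervalCutoff_support, Complex.ofReal_re]
  have hsub : Icc (1 : ℤ) M ⊆ Icc (-N : ℤ) N := Icc_subset_Icc (by omega) (by omega)
  have hcard : ((Icc (1 : ℤ) M).card : ℝ) = M := by simp
  have hterm (h₁) (hh₁ : h₁ ∈ Icc (1 : ℤ) M) (h₂) (hh₂ : h₂ ∈ Icc (1 : ℤ) M) : (M : ℝ) ^ 2 ≤
      ‖∑ x ∈ Icc (1 : ℤ) N,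
        gowersIterDiff 2 (intervalCutoff 1 N fun _ => 1) ![h₁, h₂] x‖ ^ 2 := by
    have hval : ∀ x, gowersIterDiff 2 (intervalCutoff 1 N fun _ => 1) ![h₁, h₂] x =
        ((if (1 ≤ x ∧ x ≤ N) ∧ (1 ≤ x + h₁ ∧ x + h₁ ≤ N) ∧ (1 ≤ x + h₂ ∧ x + h₂ ≤ N) ∧
          (1 ≤ x + h₂ + h₁ ∧ x + h₂ + h₁ ≤ N) then 1 else 0 : ℝ) : ℂ) := by
      intro x
      simp only [gowersIterDiff_two, intervalCutoff]
      split_ifs <;> simp_all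
    simp_rw [hval]
    rw [← Complex.ofReal_sum, Complex.norm_real, Real.norm_eq_abs, sq_abs]
    gcongr
    calc (M : ℝ) = ∑ x ∈ Icc (1 : ℤ) M, (1 : ℝ) := by simp
      _ ≤ ∑ x ∈ Icc (1 : ℤ) M, (if (1 ≤ x ∧ x ≤ N) ∧ (1 ≤ x + h₁ ∧ x + h₁ ≤ N) ∧
          (1 ≤ x + h₂ ∧ x + h₂ ≤ N) ∧ (1 ≤ x + h₂ + h₁ ∧ x + h₂ + h₁ ≤ N) then 1 else 0 : ℝ) := by
        refine sum_le_sum fun x hx => ?_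
        simp only [mem_Icc] at hx hh₁ hh₂
        rw [if_pos (by omega)]
      _ ≤ _ := sum_le_sum_of_subset_of_nonneg (Icc_subset_Icc le_rfl (by omega))
          fun x _ _ => by split_ifs <;> norm_num
  calc (M : ℝ) ^ 4 = ∑ _h₁ ∈ Icc (1 : ℤ) M, ∑ _h₂ ∈ Icc (1 : ℤ) M, (M : ℝ) ^ 2 := by
        simp only [sum_const, nsmul_eq_mul, hcard]; ring
    _ ≤ ∑ h₁ ∈ Icc (1 : ℤ) M, ∑ h₂ ∈ Icc (1 : ℤ) M, ‖∑ x ∈ Icc (1 : ℤ) N,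
        gowersIterDiff 2 (intervalCutoff 1 N fun _ => 1) ![h₁, h₂] x‖ ^ 2 :=
      sum_le_sum fun h₁ hh₁ => sum_le_sum fun h₂ hh₂ => hterm h₁ hh₁ h₂ hh₂
    _ ≤ ∑ h₁ ∈ Icc (1 : ℤ) M, ∑ h₂ ∈ Icc (-N : ℤ) N, ‖∑ x ∈ Icc (1 : ℤ) N,
        gowersIterDiff 2 (intervalCutoff 1 N fun _ => 1) ![h₁, h₂] x‖ ^ 2 :=
      sum_le_sum fun h₁ _ =>
        sum_le_sum_of_subset_of_nonneg hsub fun _ _ _ => by positivity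
    _ ≤ _ := sum_le_sum_of_subset_of_nonneg hsub fun _ _ _ => by positivity

end GowersSum

section Parallelograms

open Finset

variable {ι : Type*} (Γ : Finset ι) (z : ι → Circle)

open scoped Classical in
/-- The quadruples of indices `((p₁, p₂), (p₃, p₄))` with `z p₁ / z p₂ = z p₃ / z p₄`. -/
noncomputable def parallelograms : Finset ((ι × ι) × (ι × ι)) :=
  ((Γ ×ˢ Γ) ×ˢ (Γ ×ˢ Γ)).filter fun t => z t.1.1 / z t.1.2 = z t.2.1 / z t.2.2

variable {Γ z}

lemma mem_parallelograms {t : (ι × ι) × (ι × ι)} : t ∈ parallelograms Γ z ↔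
    ((t.1.1 ∈ Γ ∧ t.1.2 ∈ Γ) ∧ t.2.1 ∈ Γ ∧ t.2.2 ∈ Γ) ∧
      z t.1.1 / z t.1.2 = z t.2.1 / z t.2.2 := by
  simp [parallelograms]

lemma card_parallelograms_fiber_le [DecidableEq ι] {q : ι → ℕ} (hz : ∀ p ∈ Γ, z p ^ q p = 1)
    (hinj : Set.InjOn z Γ) {a b c : ℕ} (ha : 0 < a) (hb : 0 < b) (hc : 0 < c) (p : ι) :
    ((parallelograms Γ z).filter fun t =>
      ((q t.1.1, q t.1.2), (q t.2.1, t.2.2)) = ((a, b), (c, p))).card ≤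
        a.gcd b * c.gcd (a.lcm b) := by
  classical
  set s := (parallelograms Γ z).filter fun t =>
      ((q t.1.1, q t.1.2), (q t.2.1, t.2.2)) = ((a, b), (c, p)) with hs
  have hmem (t) (ht : t ∈ s) : (t.1.1 ∈ Γ ∧ t.1.2 ∈ Γ ∧ t.2.1 ∈ Γ) ∧ z t.1.1 ^ a = 1 ∧
      z t.1.2 ^ b = 1 ∧ z t.2.1 ^ c = 1 ∧ t.2.2 = p ∧
        z t.1.1 / z t.1.2 = z t.2.1 / z p := by
    obtain ⟨⟨⟨⟨h1, h2⟩, h3, h4⟩, h⟩, hq⟩ : _ ∧ _ := by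
      simpa only [hs, mem_filter, mem_parallelograms] using ht
    simp only [Prod.mk.injEq] at hq
    obtain ⟨⟨rfl, rfl⟩, rfl, rfl⟩ := hq
    exact ⟨⟨h1, h2, h3⟩, hz _ h1, hz _ h2, hz _ h3, rfl, h⟩
  refine (card_le_mul_card_image (f := fun t => z t.2.1) s (a.gcd b) fun w hw => ?_).trans
    (Nat.mul_le_mul_left _ ?_)
  · have hi : Set.InjOn (fun t : (ι × ι) × (ι × ι) => z t.1.1)
        (s.filter fun t => z t.2.1 = w : Finset _) := by
      rintro ⟨⟨t1, t2⟩, t3, t4⟩ ht ⟨⟨u1, u2⟩, u3, u4⟩ hu h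
      simp only [coe_filter, Set.mem_ofPred_eq] at ht hu h
      obtain ⟨⟨t1Γ, t2Γ, t3Γ⟩, -, -, -, t4p, t⟩ := hmem _ ht.1
      obtain ⟨⟨u1Γ, u2Γ, u3Γ⟩, -, -, -, u4p, u⟩ := hmem _ hu.1
      simp only at *
      have e1 : t1 = u1 := hinj t1Γ u1Γ h
      have e3 : t3 = u3 := hinj t3Γ u3Γ (ht.2.trans hu.2.symm)
      have e2 : t2 = u2 := by
        refine hinj t2Γ u2Γ ?_
        rw [ht.2, h] at t
        rw [hu.2] at u
        exact div_right_injective (t.trans u.symm)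
      rw [e1, e2, e3, t4p, u4p]
    rw [← card_image_of_injOn hi]
    refine Circle.card_le_of_div_pow_eq_one (Nat.gcd_pos_of_pos_left _ ha) fun x hx y hy => ?_
    simp only [mem_image, mem_filter] at hx hy
    obtain ⟨t, ⟨ht, htw⟩, rfl⟩ := hx
    obtain ⟨u, ⟨hu, huw⟩, rfl⟩ := hy
    obtain ⟨-, ta, tb, -, -, t'⟩ := hmem _ ht
    obtain ⟨-, ua, ub, -, -, u'⟩ := hmem _ hu
    have : z t.1.1 / z u.1.1 = z t.1.2 / z u.1.2 := by
      rw [div_eq_div_iff_mul_eq_mul, mul_comm (z t.1.2), ← div_eq_div_iff_mul_eq_mul, t', u', htw,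
        huw]
    refine pow_gcd_eq_one.2 ⟨?_, ?_⟩
    · rw [div_pow, ta, ua, div_one]
    · rw [this, div_pow, tb, ub, div_one]
  · refine Circle.card_le_of_div_pow_eq_one (Nat.gcd_pos_of_pos_left _ hc) fun x hx y hy => ?_
    simp only [mem_image] at hx hy
    obtain ⟨t, ht, rfl⟩ := hx
    obtain ⟨u, hu, rfl⟩ := hy
    obtain ⟨-, ta, tb, tc, -, t'⟩ := hmem _ ht
    obtain ⟨-, ua, ub, uc, -, u'⟩ := hmem _ hu
    have h1 (x : Circle) (hx : x ^ a = 1) : x ^ a.lcm b = 1 :=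
      orderOf_dvd_iff_pow_eq_one.1 ((orderOf_dvd_of_pow_eq_one hx).trans (Nat.dvd_lcm_left a b))
    have h2 (x : Circle) (hx : x ^ b = 1) : x ^ a.lcm b = 1 :=
      orderOf_dvd_iff_pow_eq_one.1 ((orderOf_dvd_of_pow_eq_one hx).trans (Nat.dvd_lcm_right a b))
    refine pow_gcd_eq_one.2 ⟨?_, ?_⟩
    · rw [div_pow, tc, uc, div_one]
    · rw [← div_div_div_cancel_right (z t.2.1) (z u.2.1) (z p), ← t', ← u']
      simp only [div_pow, h1 _ ta, h1 _ ua, h2 _ tb, h2 _ ub, div_one]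

lemma card_parallelograms_le {q : ι → ℕ} (hz : ∀ p ∈ Γ, z p ^ q p = 1)
    (hinj : Set.InjOn z Γ) {Q : ℕ} (hq : ∀ p ∈ Γ, q p ∈ Icc 1 Q) {τ : ℝ}
    (hτ : ∀ L, 0 < L → L ≤ Q ^ 2 → (L.divisors.card : ℝ) ≤ τ ^ 2)
    (hτ' : ∀ L, 0 < L → L ≤ Q → (L.divisors.card : ℝ) ≤ τ) :
    ((parallelograms Γ z).card : ℝ) ≤ Γ.card * Q ^ 3 * τ ^ 3 := by
  classical
  have hmaps : ∀ t ∈ parallelograms Γ z, ((q t.1.1, q t.1.2), (q t.2.1, t.2.2)) ∈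
      (Icc 1 Q ×ˢ Icc 1 Q) ×ˢ (Icc 1 Q ×ˢ Γ) := by
    intro t ht
    obtain ⟨⟨⟨h1, h2⟩, h3, h4⟩, -⟩ := mem_parallelograms.1 ht
    simp only [mem_product]
    exact ⟨⟨hq _ h1, hq _ h2⟩, hq _ h3, h4⟩
  have hcount : (parallelograms Γ z).card ≤
      ∑ a ∈ Icc 1 Q, ∑ b ∈ Icc 1 Q, ∑ c ∈ Icc 1 Q, ∑ _p ∈ Γ, a.gcd b * c.gcd (a.lcm b) := by
    rw [card_eq_sum_card_fiberwise hmaps, sum_product, sum_product]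
    simp_rw [sum_product]
    refine sum_le_sum fun a ha => sum_le_sum fun b hb => sum_le_sum fun c hc =>
      sum_le_sum fun p _ => ?_
    simp only [mem_Icc] at ha hb hc
    exact card_parallelograms_fiber_le hz hinj (by omega) (by omega) (by omega) p
  have hlcm (a b) (ha : a ∈ Icc 1 Q) (hb : b ∈ Icc 1 Q) :
      ∑ c ∈ Icc 1 Q, ((c.gcd (a.lcm b) : ℕ) : ℝ) ≤ Q * τ ^ 2 := by
    simp only [mem_Icc] at ha hb
    have hpos : 0 < a.lcm b := Nat.lcm_pos (by omega) (by omega)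
    have hle : a.lcm b ≤ Q ^ 2 :=
      (Nat.le_of_dvd (Nat.mul_pos (by omega) (by omega)) (Nat.lcm_dvd_mul a b)).trans
        (by rw [sq]; exact Nat.mul_le_mul ha.2 hb.2)
    calc ∑ c ∈ Icc 1 Q, ((c.gcd (a.lcm b) : ℕ) : ℝ) ≤ Q * (a.lcm b).divisors.card := by
          exact_mod_cast sum_gcd_le Q hpos.ne'
      _ ≤ _ := by gcongr; exact hτ _ hpos hle
  have hgcd (a) (ha : a ∈ Icc 1 Q) : ∑ b ∈ Icc 1 Q, ((a.gcd b : ℕ) : ℝ) ≤ Q * τ := by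
    simp only [mem_Icc] at ha
    calc ∑ b ∈ Icc 1 Q, ((a.gcd b : ℕ) : ℝ) ≤ Q * a.divisors.card := by
          simp_rw [Nat.gcd_comm a]
          exact_mod_cast sum_gcd_le Q (by omega : a ≠ 0)
      _ ≤ _ := by gcongr; exact hτ' _ (by omega) ha.2
  calc ((parallelograms Γ z).card : ℝ)
      ≤ ∑ a ∈ Icc 1 Q, ∑ b ∈ Icc 1 Q, ∑ c ∈ Icc 1 Q, ∑ _p ∈ Γ,
          ((a.gcd b : ℕ) : ℝ) * (c.gcd (a.lcm b) : ℕ) := by exact_mod_cast hcount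
    _ = Γ.card * ∑ a ∈ Icc 1 Q, ∑ b ∈ Icc 1 Q, ((a.gcd b : ℕ) : ℝ) *
          ∑ c ∈ Icc 1 Q, ((c.gcd (a.lcm b) : ℕ) : ℝ) := by
        simp only [sum_const, nsmul_eq_mul, mul_sum]
    _ ≤ Γ.card * ∑ a ∈ Icc 1 Q, ∑ b ∈ Icc 1 Q, ((a.gcd b : ℕ) : ℝ) * (Q * τ ^ 2) := by
        gcongr with a ha b hb
        exact hlcm a b ha hb
    _ ≤ Γ.card * ∑ a ∈ Icc 1 Q, Q * τ * (Q * τ ^ 2) := by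
        gcongr with a ha
        rw [← sum_mul]
        gcongr
        exact hgcd a ha
    _ = _ := by
        rw [sum_const, nsmul_eq_mul, Nat.card_Icc, Nat.add_sub_cancel]
        ring

open scoped Classical in
lemma card_parallelograms_pairs_le (hinj : Set.InjOn z Γ) :
    ((parallelograms Γ z ×ˢ parallelograms Γ z).filter fun s : ((ι × ι) × (ι × ι)) × ((ι × ι) × (ι × ι)) =>
      z s.1.2.2 / z s.1.1.2 = z s.2.2.2 / z s.2.1.2 ∧
        z s.1.2.2 / z s.1.2.1 = z s.2.2.2 / z s.2.2.1).card ≤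
      (parallelograms Γ z).card * Γ.card := by
  rw [← card_product]
  refine card_le_card_of_injOn (fun s => (s.1, s.2.2.2)) (fun s hs => ?_) ?_
  · simp only [coe_filter, mem_product, Set.mem_ofPred_eq] at hs
    exact mem_product.2 ⟨hs.1.1, (mem_parallelograms.1 hs.1.2).1.2.2⟩
  · rintro ⟨t, ⟨a1, a2⟩, a3, a4⟩ ha ⟨t', ⟨b1, b2⟩, b3, b4⟩ hb h
    simp only [Prod.mk.injEq] at h
    obtain ⟨rfl, rfl⟩ := h
    simp only [coe_filter, mem_product, Set.mem_ofPred_eq, mem_parallelograms] at ha hb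
    obtain ⟨⟨-, ⟨⟨a1Γ, a2Γ⟩, a3Γ, -⟩, a⟩, ha2, ha3⟩ := ha
    obtain ⟨⟨-, ⟨⟨b1Γ, b2Γ⟩, b3Γ, -⟩, b⟩, hb2, hb3⟩ := hb
    have e2 : a2 = b2 := hinj a2Γ b2Γ (div_right_injective (ha2.symm.trans hb2))
    have e3 : a3 = b3 := hinj a3Γ b3Γ (div_right_injective (ha3.symm.trans hb3))
    subst e2 e3
    have e1 : a1 = b1 := hinj a1Γ b1Γ (div_left_injective (a.trans b.symm))
    rw [e1]

lemma sum_box_norm_sq_le {κ : Type*} (T : Finset κ) (u v : κ → Circle) (c : κ → ℂ) {B : ℝ}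
    (hB : 0 ≤ B) (hc : ∀ t ∈ T, ‖c t‖ ≤ B) {D : ℕ}
    (hu : ∀ t ∈ T, ∀ s ∈ T, ∃ d, 0 < d ∧ d ≤ D ∧ (u t / u s) ^ d = 1)
    (hv : ∀ t ∈ T, ∀ s ∈ T, ∃ d, 0 < d ∧ d ≤ D ∧ (v t / v s) ^ d = 1)
    [DecidablePred fun s : κ × κ => u s.1 = u s.2 ∧ v s.1 = v s.2] (N : ℕ) :
    ∑ h₁ ∈ Icc (-N : ℤ) N, ∑ h₂ ∈ Icc (-N : ℤ) N,
      ‖∑ t ∈ T, c t * ((u t ^ h₁ : Circle) : ℂ) * ((v t ^ h₂ : Circle) : ℂ)‖ ^ 2 ≤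
      B ^ 2 * (((T ×ˢ T).filter fun s => u s.1 = u s.2 ∧ v s.1 = v s.2).card * (2 * N + 1) ^ 2 +
        T.card ^ 2 * ((2 * N + 1) * D)) := by
  classical
  set I := Icc (-N : ℤ) N with hI
  have hIcard : (I.card : ℝ) = 2 * N + 1 := by
    have : I.card = 2 * N + 1 := by rw [hI, Int.card_Icc]; omega
    rw [this]; push_cast; ring
  have htriv (ζ : Circle) : ‖∑ x ∈ I, ((ζ ^ x : Circle) : ℂ)‖ ≤ 2 * N + 1 := by
    refine (norm_sum_le _ _).trans ?_
    simp only [Circle.norm_coe, sum_const, nsmul_eq_mul, mul_one, hIcard, le_refl]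
  have hgeom (ζ : Circle) (h : ∃ d, 0 < d ∧ d ≤ D ∧ ζ ^ d = 1) (h1 : ζ ≠ 1) :
      ‖∑ x ∈ I, ((ζ ^ x : Circle) : ℂ)‖ ≤ D := by
    obtain ⟨d, hd, hdD, hζ⟩ := h
    exact (Circle.norm_sum_zpow_le hd hζ h1 _ _).trans (by exact_mod_cast hdD)
  have hexpand : ((∑ h₁ ∈ I, ∑ h₂ ∈ I,
      ‖∑ t ∈ T, c t * ((u t ^ h₁ : Circle) : ℂ) * ((v t ^ h₂ : Circle) : ℂ)‖ ^ 2 : ℝ) : ℂ) =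
      ∑ s ∈ T ×ˢ T, c s.1 * (starRingEnd ℂ) (c s.2) *
        ((∑ x ∈ I, (((u s.1 / u s.2) ^ x : Circle) : ℂ)) *
          ∑ x ∈ I, (((v s.1 / v s.2) ^ x : Circle) : ℂ)) := by
    push_cast
    have hsq (x y : ℤ) :
        (‖∑ t ∈ T, c t * (u t : ℂ) ^ x * (v t : ℂ) ^ y‖ : ℂ) ^ 2 =
        ∑ s ∈ T ×ˢ T, c s.1 * (starRingEnd ℂ) (c s.2) *
          (((u s.1 : ℂ) / u s.2) ^ x * ((v s.1 : ℂ) / v s.2) ^ y) := by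
      rw [← Complex.mul_conj', map_sum, sum_mul_sum, ← sum_product']
      refine sum_congr rfl fun s _ => ?_
      simp only [map_mul, map_zpow₀, div_zpow, ← Circle.coe_inv_eq_conj, Circle.coe_inv, inv_zpow]
      ring
    simp_rw [hsq, sum_comm (t := T ×ˢ T), sum_mul_sum, mul_sum]
  set R := ∑ h₁ ∈ I, ∑ h₂ ∈ I,
      ‖∑ t ∈ T, c t * ((u t ^ h₁ : Circle) : ℂ) * ((v t ^ h₂ : Circle) : ℂ)‖ ^ 2 with hR
  have hR0 : R = ‖(R : ℂ)‖ := by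
    rw [Complex.norm_real, Real.norm_of_nonneg (by positivity)]
  rw [hR0, hexpand]
  have hpair : ∀ s ∈ T ×ˢ T, ‖c s.1 * (starRingEnd ℂ) (c s.2) *
        ((∑ x ∈ I, (((u s.1 / u s.2) ^ x : Circle) : ℂ)) *
          ∑ x ∈ I, (((v s.1 / v s.2) ^ x : Circle) : ℂ))‖ ≤
      B ^ 2 * ((if u s.1 = u s.2 ∧ v s.1 = v s.2 then (2 * N + 1 : ℝ) ^ 2 else 0) +
        (2 * N + 1) * D) := by
    intro s hs
    obtain ⟨h1, h2⟩ := mem_product.1 hs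
    rw [norm_mul, norm_mul, norm_mul, RCLike.norm_conj, sq B]
    refine mul_le_mul (mul_le_mul (hc _ h1) (hc _ h2) (norm_nonneg _) hB) ?_ (by positivity)
      (by positivity)
    split_ifs with h
    · calc _ ≤ (2 * N + 1 : ℝ) * (2 * N + 1) :=
            mul_le_mul (htriv _) (htriv _) (norm_nonneg _) (by positivity)
        _ ≤ _ := by rw [← sq]; exact le_add_of_nonneg_right (by positivity)
    · rw [zero_add]
      by_cases h' : u s.1 = u s.2
      · exact mul_le_mul (htriv _) (hgeom _ (hv _ h1 _ h2) fun e => h ⟨h', div_eq_one.1 e⟩)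
          (norm_nonneg _) (by positivity)
      · rw [mul_comm]
        exact mul_le_mul (htriv _) (hgeom _ (hu _ h1 _ h2) fun e => h' (div_eq_one.1 e))
          (norm_nonneg _) (by positivity)
  refine (norm_sum_le_of_le _ hpair).trans_eq ?_
  rw [← mul_sum, sum_add_distrib, ← sum_filter, sum_const, sum_const, card_product]
  simp only [nsmul_eq_mul]
  push_cast
  ring

lemma norm_sum_correlation_le (c : ι → ℂ) (hc : ∀ p ∈ Γ, ‖c p‖ ≤ 1) {q : ι → ℕ} {Q : ℕ}
    (hz : ∀ p ∈ Γ, z p ^ q p = 1) (hq : ∀ p ∈ Γ, q p ∈ Icc 1 Q) {w : ℤ → ℂ}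
    (hw : ∀ n, w n = ∑ p ∈ Γ, c p * ((z p ^ n : Circle) : ℂ)) (a b h₁ h₂ : ℤ) {N : ℕ}
    (hab : b + 1 - a ≤ N) :
    ‖∑ x ∈ Icc a b, w x * (starRingEnd ℂ) (w (x + h₁)) *
      (starRingEnd ℂ) (w (x + h₂) * (starRingEnd ℂ) (w (x + h₂ + h₁)))‖ ≤
    N * ‖∑ t ∈ parallelograms Γ z, c t.1.1 * (starRingEnd ℂ) (c t.1.2) *
      ((starRingEnd ℂ) (c t.2.1) * c t.2.2) * (((z t.2.2 / z t.1.2) ^ h₁ : Circle) : ℂ) *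
        (((z t.2.2 / z t.2.1) ^ h₂ : Circle) : ℂ)‖ + Γ.card ^ 4 * Q ^ 4 := by
  classical
  set A : (ι × ι) × (ι × ι) → ℂ := fun t => c t.1.1 * (starRingEnd ℂ) (c t.1.2) *
      ((starRingEnd ℂ) (c t.2.1) * c t.2.2) * (((z t.2.2 / z t.1.2) ^ h₁ : Circle) : ℂ) *
        (((z t.2.2 / z t.2.1) ^ h₂ : Circle) : ℂ) with hA
  set ζ : (ι × ι) × (ι × ι) → Circle :=
    fun t => (z t.1.1 / z t.1.2) / (z t.2.1 / z t.2.2) with hζ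
  have hexp (x : ℤ) : w x * (starRingEnd ℂ) (w (x + h₁)) *
      (starRingEnd ℂ) (w (x + h₂) * (starRingEnd ℂ) (w (x + h₂ + h₁))) =
      ∑ t ∈ (Γ ×ˢ Γ) ×ˢ (Γ ×ˢ Γ), A t * ((ζ t ^ x : Circle) : ℂ) := by
    simp_rw [hw, map_mul, map_sum, Complex.conj_conj]
    rw [sum_mul_sum_mul_sum_mul_sum]
    refine sum_congr rfl fun t _ => ?_
    simp only [hA, hζ, map_mul, map_zpow₀, div_zpow, Circle.coe_div, Circle.coe_zpow,
      ← Circle.coe_inv_eq_conj, Circle.coe_inv,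
      zpow_add₀ (Circle.coe_ne_zero _), inv_zpow]
    field_simp
  simp_rw [hexp]
  rw [sum_comm]
  simp_rw [← mul_sum]
  rw [← sum_filter_add_sum_filter_not _ (fun t => z t.1.1 / z t.1.2 = z t.2.1 / z t.2.2)]
  refine (norm_add_le _ _).trans (add_le_add ?_ ?_)
  · have hcard : ((Icc a b).card : ℝ) ≤ N := by
      have : (Icc a b).card ≤ N := by rw [Int.card_Icc]; omega
      exact_mod_cast this
    have : ∑ t ∈ ((Γ ×ˢ Γ) ×ˢ (Γ ×ˢ Γ)).filter fun t => z t.1.1 / z t.1.2 = z t.2.1 / z t.2.2,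
        A t * ∑ x ∈ Icc a b, ((ζ t ^ x : Circle) : ℂ) =
        (Icc a b).card * ∑ t ∈ parallelograms Γ z, A t := by
      rw [parallelograms, mul_sum]
      refine sum_congr (by congr) fun t ht => ?_
      have h1 : ζ t = 1 := div_eq_one.2 (mem_filter.1 ht).2
      simp [h1, mul_comm]
    rw [this, norm_mul, Complex.norm_natCast]
    gcongr
  · have hterm : ∀ t ∈ ((Γ ×ˢ Γ) ×ˢ (Γ ×ˢ Γ)).filter
        (fun t => ¬ z t.1.1 / z t.1.2 = z t.2.1 / z t.2.2),
        ‖A t * ∑ x ∈ Icc a b, ((ζ t ^ x : Circle) : ℂ)‖ ≤ (Q : ℝ) ^ 4 := by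
      intro t ht
      simp only [mem_filter, mem_product] at ht
      obtain ⟨⟨⟨t1, t2⟩, t3, t4⟩, hne⟩ := ht
      have hA1 : ‖A t‖ ≤ 1 := by
        simp only [hA, norm_mul, RCLike.norm_conj, Circle.norm_coe, mul_one]
        exact mul_le_one₀ (mul_le_one₀ (hc _ t1) (norm_nonneg _) (hc _ t2)) (by positivity)
          (mul_le_one₀ (hc _ t3) (norm_nonneg _) (hc _ t4))
      obtain ⟨q1, Q1⟩ := mem_Icc.1 (hq _ t1)
      obtain ⟨q2, Q2⟩ := mem_Icc.1 (hq _ t2)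
      obtain ⟨q3, Q3⟩ := mem_Icc.1 (hq _ t3)
      obtain ⟨q4, Q4⟩ := mem_Icc.1 (hq _ t4)
      obtain ⟨d, hd, hdQ, hζd⟩ := exists_pow_eq_one_of_four (hz _ t1) (hz _ t2) (hz _ t3)
        (hz _ t4) q1 q2 q3 q4 Q1 Q2 Q3 Q4
      have hgeom := Circle.norm_sum_zpow_le hd hζd (fun h => hne (div_eq_one.1 h)) a b
      rw [norm_mul]
      calc _ ≤ 1 * (d : ℝ) := mul_le_mul hA1 hgeom (norm_nonneg _) zero_le_one
        _ ≤ _ := by rw [one_mul]; exact_mod_cast hdQ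
    refine (norm_sum_le_of_le _ hterm).trans ?_
    rw [sum_const, nsmul_eq_mul]
    gcongr
    calc _ ≤ ((((Γ ×ˢ Γ) ×ˢ (Γ ×ˢ Γ)).card : ℕ) : ℝ) := by
          exact_mod_cast card_filter_le _ _
      _ = _ := by rw [card_product, card_product]; push_cast; ring

lemma gowersSum_three_trigPoly_le (c : ι → ℂ) {σ : ℝ} (hσ : 0 ≤ σ) (hσ1 : σ ≤ 1)
    (hc : ∀ p ∈ Γ, ‖c p‖ ≤ σ) {q : ι → ℕ} {Q : ℕ} (hz : ∀ p ∈ Γ, z p ^ q p = 1)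
    (hinj : Set.InjOn z Γ) (hq : ∀ p ∈ Γ, q p ∈ Icc 1 Q) {w : ℤ → ℂ}
    (hw : ∀ n, w n = ∑ p ∈ Γ, c p * ((z p ^ n : Circle) : ℂ)) (N : ℕ) :
    (gowersSum 3 (intervalCutoff 1 N w)).re ≤
      2 * N ^ 2 * (σ ^ 8 * ((parallelograms Γ z).card * Γ.card * (2 * N + 1) ^ 2 +
        Γ.card ^ 8 * ((2 * N + 1) * Q ^ 4))) + 2 * (2 * N + 1) ^ 2 * (Γ.card ^ 4 * Q ^ 4) ^ 2 := by
  classical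
  set P := parallelograms Γ z with hP
  set A : (ι × ι) × (ι × ι) → ℂ := fun t => c t.1.1 * (starRingEnd ℂ) (c t.1.2) *
      ((starRingEnd ℂ) (c t.2.1) * c t.2.2) with hA
  set u : (ι × ι) × (ι × ι) → Circle := fun t => z t.2.2 / z t.1.2 with hu
  set v : (ι × ι) × (ι × ι) → Circle := fun t => z t.2.2 / z t.2.1 with hv
  set E : ℝ := Γ.card ^ 4 * Q ^ 4 with hE
  have hbox := sum_box_norm_sq_le P u v A (B := σ ^ 4) (by positivity) (fun t ht => by
      obtain ⟨⟨⟨t1, t2⟩, t3, t4⟩, -⟩ := mem_parallelograms.1 ht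
      simp only [hA, norm_mul, RCLike.norm_conj]
      calc _ ≤ σ * σ * (σ * σ) := by
            gcongr
            exacts [hc _ t1, hc _ t2, hc _ t3, hc _ t4]
        _ = σ ^ 4 := by ring) (D := Q ^ 4) (fun t ht s hs => by
      obtain ⟨⟨⟨t1, t2⟩, t3, t4⟩, -⟩ := mem_parallelograms.1 ht
      obtain ⟨⟨⟨s1, s2⟩, s3, s4⟩, -⟩ := mem_parallelograms.1 hs
      have hq' := fun p hp => mem_Icc.1 (hq p hp)
      exact exists_pow_eq_one_of_four (hz _ t4) (hz _ t2) (hz _ s4) (hz _ s2) (hq' _ t4).1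
        (hq' _ t2).1 (hq' _ s4).1 (hq' _ s2).1 (hq' _ t4).2 (hq' _ t2).2 (hq' _ s4).2 (hq' _ s2).2)
      (fun t ht s hs => by
      obtain ⟨⟨⟨t1, t2⟩, t3, t4⟩, -⟩ := mem_parallelograms.1 ht
      obtain ⟨⟨⟨s1, s2⟩, s3, s4⟩, -⟩ := mem_parallelograms.1 hs
      have hq' := fun p hp => mem_Icc.1 (hq p hp)
      exact exists_pow_eq_one_of_four (hz _ t4) (hz _ t3) (hz _ s4) (hz _ s3) (hq' _ t4).1
        (hq' _ t3).1 (hq' _ s4).1 (hq' _ s3).1 (hq' _ t4).2 (hq' _ t3).2 (hq' _ s4).2 (hq' _ s3).2)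
      N
  have hpairs : (((P ×ˢ P).filter fun s => u s.1 = u s.2 ∧ v s.1 = v s.2).card : ℝ) ≤
      P.card * Γ.card := by
    exact_mod_cast (card_le_card (by intro s hs; simpa using hs)).trans
      (card_parallelograms_pairs_le hinj)
  have hPcard : (P.card : ℝ) ^ 2 ≤ Γ.card ^ 8 := by
    have : P.card ≤ Γ.card ^ 4 := (card_filter_le _ _).trans_eq (by
      rw [card_product, card_product]; ring)
    calc (P.card : ℝ) ^ 2 ≤ ((Γ.card : ℝ) ^ 4) ^ 2 := by gcongr; exact_mod_cast this
      _ = _ := by ring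
  have hIcard : ((Icc (-N : ℤ) N).card : ℝ) = 2 * N + 1 := by
    have : (Icc (-N : ℤ) N).card = 2 * N + 1 := by rw [Int.card_Icc]; omega
    rw [this]; push_cast; ring
  rw [gowersSum_three intervalCutoff_support, Complex.ofReal_re]
  have hterm (h₁ h₂ : ℤ) : ‖∑ x ∈ Icc (1 : ℤ) N,
      gowersIterDiff 2 (intervalCutoff 1 N w) ![h₁, h₂] x‖ ^ 2 ≤
      2 * N ^ 2 * ‖∑ t ∈ P, A t * ((u t ^ h₁ : Circle) : ℂ) * ((v t ^ h₂ : Circle) : ℂ)‖ ^ 2 +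
        2 * E ^ 2 := by
    obtain ⟨a, b, hab, heq⟩ := sum_gowersIterDiff_intervalCutoff w N h₁ h₂
    have hcorr := norm_sum_correlation_le c (fun p hp => (hc p hp).trans hσ1) hz hq hw a b h₁ h₂ hab
    rw [heq]
    simp_rw [gowersIterDiff_two]
    refine (pow_le_pow_left₀ (norm_nonneg _) hcorr 2).trans (add_sq_le.trans_eq ?_)
    ring
  calc _ ≤ ∑ h₁ ∈ Icc (-N : ℤ) N, ∑ h₂ ∈ Icc (-N : ℤ) N, (2 * N ^ 2 *
        ‖∑ t ∈ P, A t * ((u t ^ h₁ : Circle) : ℂ) * ((v t ^ h₂ : Circle) : ℂ)‖ ^ 2 +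
        2 * E ^ 2) := sum_le_sum fun h₁ _ => sum_le_sum fun h₂ _ => hterm h₁ h₂
    _ = 2 * N ^ 2 * (∑ h₁ ∈ Icc (-N : ℤ) N, ∑ h₂ ∈ Icc (-N : ℤ) N,
        ‖∑ t ∈ P, A t * ((u t ^ h₁ : Circle) : ℂ) * ((v t ^ h₂ : Circle) : ℂ)‖ ^ 2) +
        2 * (2 * N + 1) ^ 2 * E ^ 2 := by
      simp only [sum_add_distrib, ← mul_sum, sum_const, nsmul_eq_mul, hIcard]
      ring
    _ ≤ _ := by
      refine add_le_add_left (mul_le_mul_of_nonneg_left (hbox.trans ?_) (by positivity)) _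
      push_cast
      rw [← pow_mul]
      gcongr

end Parallelograms

/-- The point `e(a / q)` of the unit circle attached to the pair `(q, a)`. -/
noncomputable def fracCircle (p : (_ : ℕ) × ℕ) : Circle :=
  Circle.exp (2 * Real.pi * ((p.2 : ℝ) / p.1))

lemma expCirc_mul_div (n : ℤ) (p : (_ : ℕ) × ℕ) :
    expCirc ((n : ℝ) * p.2 / p.1) = ((fracCircle p ^ n : Circle) : ℂ) := by
  rw [expCirc, fracCircle, Circle.coe_zpow, Circle.coe_exp, ← Complex.exp_int_mul]
  congr 1
  push_cast
  ring

lemma fracCircle_pow {p : (_ : ℕ) × ℕ} (hp : p.1 ≠ 0) : fracCircle p ^ p.1 = 1 := by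
  have hp' : (p.1 : ℂ) ≠ 0 := by exact_mod_cast hp
  refine Circle.ext ?_
  rw [fracCircle, Circle.coe_pow, Circle.coe_exp, ← Complex.exp_nat_mul, Circle.coe_one,
    Complex.exp_eq_one_iff]
  refine ⟨p.2, ?_⟩
  push_cast
  field_simp

lemma mem_gammaIndex {Q : ℕ} {p : (_ : ℕ) × ℕ} : p ∈ gammaIndex Q ↔
    (Q / 2 < p.1 ∧ p.1 ≤ Q) ∧ p.2 < p.1 ∧ p.2.Coprime p.1 := by
  simp [gammaIndex]

lemma fracCircle_injOn (Q : ℕ) : Set.InjOn fracCircle (gammaIndex Q) := by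
  rintro ⟨q, a⟩ hp ⟨r, b⟩ hp' h
  simp only [Finset.mem_coe, mem_gammaIndex] at hp hp'
  obtain ⟨-, haq, hcop⟩ := hp
  obtain ⟨-, hbr, hcop'⟩ := hp'
  have hq : (0 : ℝ) < q := by exact_mod_cast (by omega : 0 < q)
  have hr : (0 : ℝ) < r := by exact_mod_cast (by omega : 0 < r)
  obtain ⟨m, hm⟩ := Circle.exp_eq_exp.1 h
  have hm' : (a : ℝ) / q - b / r = m := by
    have : 2 * Real.pi * ((a : ℝ) / q - b / r - m) = 0 := by
      simp only at hm
      linear_combination hm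
    have := (mul_eq_zero.1 this).resolve_left (by positivity)
    linarith
  have ha1 : (a : ℝ) / q < 1 := (div_lt_one hq).2 (by exact_mod_cast haq)
  have hb1 : (b : ℝ) / r < 1 := (div_lt_one hr).2 (by exact_mod_cast hbr)
  have ha0 : 0 ≤ (a : ℝ) / q := by positivity
  have hb0 : 0 ≤ (b : ℝ) / r := by positivity
  have hm1 : m < 1 := by exact_mod_cast (by linarith : (m : ℝ) < 1)
  have hm2 : -1 < m := by exact_mod_cast (by linarith : (-1 : ℝ) < m)
  have hm0 : m = 0 := by omega
  rw [hm0, Int.cast_zero, sub_eq_zero, div_eq_div_iff hq.ne' hr.ne'] at hm'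
  have hmul : a * r = b * q := by exact_mod_cast hm'
  have hqr : q = r := Nat.dvd_antisymm
    (hcop.symm.dvd_of_dvd_mul_left ⟨b, by rw [hmul, mul_comm]⟩)
    (hcop'.symm.dvd_of_dvd_mul_left ⟨a, by rw [← hmul, mul_comm]⟩)
  subst hqr
  have hab : a = b := Nat.eq_of_mul_eq_mul_right (by omega) hmul
  rw [hab]

lemma card_gammaIndex_le (Q : ℕ) : (gammaIndex Q).card ≤ Q ^ 2 := by
  rw [gammaIndex, Finset.card_sigma]
  calc _ ≤ ∑ _q ∈ Finset.Ioc (Q / 2) Q, Q := Finset.sum_le_sum fun q hq =>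
        (Finset.card_filter_le _ _).trans (by simpa using (Finset.mem_Ioc.1 hq).2)
    _ ≤ Q ^ 2 := by
        rw [Finset.sum_const, smul_eq_mul, Nat.card_Ioc, sq]
        exact Nat.mul_le_mul_right _ (Nat.sub_le _ _)

lemma exists_card_parallelograms_gammaIndex_le : ∃ C : ℝ, 0 < C ∧ ∀ Q : ℕ, 1 ≤ Q →
    ((parallelograms (gammaIndex Q) fracCircle).card : ℝ) ≤ C * (Q : ℝ) ^ (43 / 8 : ℝ) := by
  obtain ⟨C₀, hC₀, hdiv⟩ := exists_card_divisors_pow_le 8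
  refine ⟨(C₀ : ℝ) ^ (3 / 8 : ℝ), by positivity, fun Q hQ => ?_⟩
  have hQ0 : (0 : ℝ) < Q := by exact_mod_cast hQ
  set τ : ℝ := ((C₀ : ℝ) * Q) ^ (1 / 8 : ℝ) with hτ
  have hτ0 : 0 ≤ τ := by positivity
  have hτ8 : τ ^ 8 = C₀ * Q := by
    rw [hτ, ← Real.rpow_natCast, ← Real.rpow_mul (by positivity)]
    norm_num
  have hdiv' (L : ℕ) (hL : 0 < L) : (L.divisors.card : ℝ) ^ 8 ≤ C₀ * L := by
    exact_mod_cast hdiv L hL.ne'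
  have hcount := card_parallelograms_le (Γ := gammaIndex Q) (z := fracCircle)
    (q := fun p => p.1) (fun p hp => fracCircle_pow (by have := mem_gammaIndex.1 hp; omega))
    (fracCircle_injOn Q) (Q := Q)
    (fun p hp => Finset.mem_Icc.2 (by have := mem_gammaIndex.1 hp; omega)) (τ := τ)
    (fun L hL hLQ => by
      refine le_of_pow_le_pow_left₀ (n := 8) (by norm_num) (by positivity)
        ((hdiv' L hL).trans ?_)
      have h1 : (L : ℝ) ≤ (Q : ℝ) ^ 2 := by exact_mod_cast hLQ
      have h2 : (C₀ : ℝ) ≤ (C₀ : ℝ) ^ 2 := by exact_mod_cast Nat.le_self_pow two_ne_zero C₀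
      calc (C₀ : ℝ) * L ≤ (C₀ : ℝ) ^ 2 * (Q : ℝ) ^ 2 := by gcongr
        _ = (τ ^ 2) ^ 8 := by rw [← pow_mul, mul_comm 2 8, pow_mul, hτ8]; ring)
    (fun L hL hLQ => by
      refine le_of_pow_le_pow_left₀ (n := 8) (by norm_num) (by positivity)
        ((hdiv' L hL).trans ?_)
      rw [hτ8]
      gcongr)
  have hΓ : ((gammaIndex Q).card : ℝ) ≤ (Q : ℝ) ^ 2 := by exact_mod_cast card_gammaIndex_le Q
  have hτ3 : τ ^ 3 = (C₀ : ℝ) ^ (3 / 8 : ℝ) * (Q : ℝ) ^ (3 / 8 : ℝ) := by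
    rw [hτ, ← Real.rpow_natCast, ← Real.rpow_mul (by positivity),
      Real.mul_rpow (by positivity) (by positivity)]
    norm_num
  calc _ ≤ (Q : ℝ) ^ 2 * Q ^ 3 * τ ^ 3 := hcount.trans (by gcongr)
    _ = (C₀ : ℝ) ^ (3 / 8 : ℝ) * ((Q : ℝ) ^ (5 : ℕ) * (Q : ℝ) ^ (3 / 8 : ℝ)) := by
        rw [hτ3]; ring
    _ = _ := by
        rw [← Real.rpow_natCast, ← Real.rpow_add hQ0]
        norm_num

lemma exists_gowersSum_majorArcSlice_le : ∃ K : ℝ, 0 < K ∧ ∀ Q : ℕ, 2 ≤ Q →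
    ∀ S : ℕ → ℕ → ℂ,
    (∀ p ∈ gammaIndex Q, ‖S p.1 p.2‖ ≤ (p.1 : ℝ) ^ ((1 / 100 : ℝ) - 1)) →
    ∀ N : ℕ, (Q : ℝ) ^ (100 : ℕ) ≤ (N : ℝ) →
    (gowersSum 3 (intervalCutoff 1 N (majorArcSlice Q S))).re ≤
      K * N ^ 4 * (Q : ℝ) ^ (-(6 / 13) : ℝ) := by
  obtain ⟨C, hC, hP⟩ := exists_card_parallelograms_gammaIndex_le
  refine ⟨4608 * C + 24, by positivity, fun Q hQ S hS N hN => ?_⟩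
  have hQ1 : (1 : ℝ) ≤ Q := by exact_mod_cast (by omega : 1 ≤ Q)
  have hQ0 : (0 : ℝ) < Q := by linarith
  have hN1 : (1 : ℝ) ≤ N := (one_le_pow₀ hQ1).trans hN
  set Y : ℝ := (Q : ℝ) ^ (-(6 / 13) : ℝ) with hY
  have hQY : (Q : ℝ)⁻¹ ≤ Y := by
    rw [← Real.rpow_neg_one]
    exact Real.rpow_le_rpow_of_exponent_le hQ1 (by norm_num)
  set σ : ℝ := min 1 (2 * (Q : ℝ) ^ ((1 / 100 : ℝ) - 1)) with hσ
  have hσ0 : 0 ≤ σ := le_min zero_le_one (by positivity)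
  have hσ1 : σ ≤ 1 := min_le_left _ _
  have hSσ : ∀ p ∈ gammaIndex Q, ‖S p.1 p.2‖ ≤ σ := by
    intro p hp
    have hp' := mem_gammaIndex.1 hp
    have hp1 : (1 : ℝ) ≤ p.1 := by exact_mod_cast (by omega : 1 ≤ p.1)
    have hp2 : (Q : ℝ) / 2 ≤ p.1 := by
      have : (Q : ℝ) ≤ 2 * p.1 := by exact_mod_cast (by omega : Q ≤ 2 * p.1)
      linarith
    refine (hS p hp).trans (le_min (Real.rpow_le_one_of_one_le_of_nonpos hp1 (by norm_num)) ?_)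
    calc (p.1 : ℝ) ^ ((1 / 100 : ℝ) - 1) ≤ ((Q : ℝ) / 2) ^ ((1 / 100 : ℝ) - 1) :=
          Real.rpow_le_rpow_of_nonpos (by positivity) hp2 (by norm_num)
      _ = 2 ^ (-((1 / 100 : ℝ) - 1)) * (Q : ℝ) ^ ((1 / 100 : ℝ) - 1) := by
          rw [Real.div_rpow hQ0.le zero_le_two, Real.rpow_neg zero_le_two]; ring
      _ ≤ 2 ^ (1 : ℝ) * (Q : ℝ) ^ ((1 / 100 : ℝ) - 1) := by
          gcongr
          · norm_num
          · norm_num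
      _ = _ := by rw [Real.rpow_one]
  have hσ8 : σ ^ 8 ≤ 256 * (Q : ℝ) ^ (8 * ((1 / 100 : ℝ) - 1)) := by
    calc σ ^ 8 ≤ (2 * (Q : ℝ) ^ ((1 / 100 : ℝ) - 1)) ^ 8 := by gcongr; exact min_le_right _ _
      _ = _ := by
        rw [mul_pow, ← Real.rpow_natCast ((Q : ℝ) ^ _), ← Real.rpow_mul hQ0.le, mul_comm (_ - _)]
        norm_num
  have hmain := gowersSum_three_trigPoly_le (Γ := gammaIndex Q) (z := fracCircle)
    (fun p => S p.1 p.2) hσ0 hσ1 hSσ (q := fun p => p.1) (Q := Q)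
    (fun p hp => fracCircle_pow (by have := mem_gammaIndex.1 hp; omega))
    (fracCircle_injOn Q)
    (fun p hp => Finset.mem_Icc.2 (by have := mem_gammaIndex.1 hp; omega))
    (w := majorArcSlice Q S) (fun n => by simp only [majorArcSlice, expCirc_mul_div]) N
  have hΓ : ((gammaIndex Q).card : ℝ) ≤ (Q : ℝ) ^ 2 := by exact_mod_cast card_gammaIndex_le Q
  have hN3 : 2 * (N : ℝ) + 1 ≤ 3 * N := by linarith
  set P : ℝ := ((parallelograms (gammaIndex Q) fracCircle).card : ℝ) with hPdef
  have hP0 : 0 ≤ P := by positivity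
  have hdiag : σ ^ 8 * (P * Q ^ 2) ≤ 256 * C * Y := by
    calc σ ^ 8 * (P * Q ^ 2) ≤ (256 * (Q : ℝ) ^ (8 * ((1 / 100 : ℝ) - 1))) *
          ((C * (Q : ℝ) ^ (43 / 8 : ℝ)) * (Q : ℝ) ^ (2 : ℝ)) := by
          rw [Real.rpow_two]
          gcongr
          exact hP Q (by omega)
      _ = 256 * C * (Q : ℝ) ^ (8 * ((1 / 100 : ℝ) - 1) + 43 / 8 + 2) := by
          rw [Real.rpow_add hQ0, Real.rpow_add hQ0]; ring
      _ ≤ _ := by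
          gcongr
          exact Real.rpow_le_rpow_of_exponent_le hQ1 (by norm_num)
  have hNbig (k : ℕ) (hk : k ≤ 99) : (Q : ℝ) ^ k ≤ N * Y := by
    calc (Q : ℝ) ^ k = (Q : ℝ) ^ (k + 1) * (Q : ℝ)⁻¹ := by rw [pow_succ]; field_simp
      _ ≤ N * Y := by
        refine mul_le_mul ((pow_le_pow_right₀ hQ1 (by omega)).trans hN) hQY (by positivity)
          (by positivity)
  have hoff : (N : ℝ) ^ 2 * Q ^ 24 ≤ N ^ 4 * Y := by
    calc (N : ℝ) ^ 2 * Q ^ 24 ≤ N ^ 2 * (N * Y) := by gcongr; exact hNbig 24 (by norm_num)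
      _ = N ^ 3 * Y := by ring
      _ ≤ N ^ 4 * Y := by
        gcongr
        norm_num
  calc _ ≤ 2 * (N : ℝ) ^ 2 * (σ ^ 8 * (P * Q ^ 2 * (3 * N) ^ 2) +
        1 * (((Q : ℝ) ^ 2) ^ 8 * ((3 * N) * Q ^ 4))) +
        2 * (3 * N) ^ 2 * (((Q : ℝ) ^ 2) ^ 4 * Q ^ 4) ^ 2 := by
        refine hmain.trans ?_
        rw [mul_add (σ ^ 8)]
        gcongr
        exact pow_le_one₀ hσ0 hσ1
    _ = 18 * N ^ 4 * (σ ^ 8 * (P * Q ^ 2)) + 6 * N ^ 3 * Q ^ 20 + 18 * (N ^ 2 * Q ^ 24) := by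
        ring
    _ ≤ 18 * N ^ 4 * (256 * C * Y) + 6 * N ^ 3 * (N * Y) + 18 * (N ^ 4 * Y) := by
        gcongr
        exact hNbig 20 (by norm_num)
    _ = _ := by ring

/-- **`U³` savings for major-arc weights.** For every `ε > 0` there are `δ > 0` and `C` such
that for all `Q ≥ 2`, all coefficients with `|S(a/q)| ≤ q^{δ-1}` on `Γ_Q`, and all
`N ≥ Q^{100}`: `‖w_Q‖_{U³([N])} ≤ C Q^{ε - 3/52}`. -/
theorem majorArcSlice_U3_estimate (ε : ℝ) (hε : 0 < ε) :
    ∃ δ : ℝ, 0 < δ ∧ ∃ C : ℝ, ∀ Q : ℕ, 2 ≤ Q → ∀ S : ℕ → ℕ → ℂ,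
    (∀ p ∈ gammaIndex Q, ‖S p.1 p.2‖ ≤ (p.1 : ℝ) ^ (δ - 1)) →
    ∀ N : ℕ, (Q : ℝ) ^ (100 : ℕ) ≤ (N : ℝ) →
    gowersNormOn 3 N (majorArcSlice Q S) ≤ C * (Q : ℝ) ^ (ε - 3 / 52) := by
  obtain ⟨K, hK, hbound⟩ := exists_gowersSum_majorArcSlice_le
  refine ⟨1 / 100, by norm_num, (4096 * K) ^ (1 / 8 : ℝ), fun Q hQ S hS N hN => ?_⟩
  have hQ2 : (2 : ℝ) ≤ Q := by exact_mod_cast hQ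
  have hQ1 : (1 : ℝ) ≤ Q := by linarith
  have hN4 : 4 ≤ N := by
    have : (4 : ℝ) ≤ N := by
      calc (4 : ℝ) ≤ 2 ^ 100 := by norm_num
        _ ≤ (Q : ℝ) ^ 100 := by gcongr
        _ ≤ N := hN
    exact_mod_cast this
  have hN0 : (0 : ℝ) < N := by exact_mod_cast (by omega : 0 < N)
  have hlower : ((N : ℝ) / 8) ^ 4 ≤ (gowersSum 3 (intervalCutoff 1 N fun _ => 1)).re := by
    refine le_trans ?_ (gowersSum_three_one_ge (N / 4) N (Nat.mul_div_le N 4))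
    have : (N : ℝ) ≤ 8 * (N / 4 : ℕ) := by exact_mod_cast (by omega : N ≤ 8 * (N / 4))
    gcongr
    linarith
  have hnonneg : 0 ≤ (gowersSum 3 (intervalCutoff 1 N (majorArcSlice Q S))).re := by
    rw [gowersSum_three intervalCutoff_support, Complex.ofReal_re]
    positivity
  have h8 : (1 : ℝ) / 2 ^ 3 = 1 / 8 := by norm_num
  rw [gowersNormOn, gowersNorm, gowersNorm, h8,
    ← Real.div_rpow hnonneg (le_trans (by positivity) hlower)]
  calc _ ≤ ((K * N ^ 4 * (Q : ℝ) ^ (-(6 / 13) : ℝ)) / ((N : ℝ) / 8) ^ 4) ^ (1 / 8 : ℝ) := by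
        refine Real.rpow_le_rpow
          (div_nonneg hnonneg (le_trans (by positivity) hlower)) ?_ (by norm_num)
        exact div_le_div₀ (by positivity) (hbound Q hQ S hS N hN) (by positivity) hlower
    _ = ((4096 * K) * (Q : ℝ) ^ (-(6 / 13) : ℝ)) ^ (1 / 8 : ℝ) := by
        congr 1
        field_simp
        norm_num
    _ = (4096 * K) ^ (1 / 8 : ℝ) * (Q : ℝ) ^ (-(3 / 52) : ℝ) := by
        rw [Real.mul_rpow (by positivity) (by positivity), ← Real.rpow_mul (by positivity)]
        norm_num
    _ ≤ _ := by
        gcongr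
        linarith
end

section
/- Let (X,μ) be a measure space, let C₀ ≥ 0, let 0 < t ≤ 1/100 and λ ≥ 0, and let (f_N)_{N≥1} be measurable functions X → ℂ with |f_N(x)| ≤ 1 for all x and N, satisfying the Lipschitz-in-time property |f_N(x) − f_M(x)| ≤ C₀·|N−M|/N for all x ∈ X and all integers M, N with N/2 ≤ M ≤ N. If ε₁ ≥ 0 is such that μ({x : limsup_{j→∞} |f_{K·2^j}(x)| ≥ λ}) ≤ ε₁ for every integer K with 10/t ≤ K ≤ 200/t, then μ({x : limsup_{N→∞} |f_N(x)| ≥ λ + C₀·t}) ≤ 200·t^{−1}·ε₁. -/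
open MeasureTheory Filter
open scoped ENNReal

/-- Every `N ≥ A * 2 ^ J` lies in a dyadic block `[K * 2 ^ j, (K + 1) * 2 ^ j)` with
`A ≤ K < 2 * A` and `J ≤ j`. -/
theorem exists_mul_two_pow_le_lt {A J N : ℕ} (hA : 0 < A) (hN : A * 2 ^ J ≤ N) :
    ∃ K j : ℕ, A ≤ K ∧ K < 2 * A ∧ J ≤ j ∧ K * 2 ^ j ≤ N ∧ N < (K + 1) * 2 ^ j := by
  have hJ : 2 ^ J ≤ N / A := by rwa [Nat.le_div_iff_mul_le hA, mul_comm]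
  have hne : N / A ≠ 0 := (lt_of_lt_of_le (by positivity) hJ).ne'
  have h1 : 2 ^ Nat.log 2 (N / A) ≤ N / A := Nat.pow_log_le_self 2 hne
  have h2 : N / A < 2 ^ (Nat.log 2 (N / A) + 1) := Nat.lt_pow_succ_log_self (by norm_num) _
  have hj : J ≤ Nat.log 2 (N / A) := Nat.le_log_of_pow_le (by norm_num) hJ
  generalize Nat.log 2 (N / A) = j at h1 h2 hj
  have hp : 0 < 2 ^ j := by positivity
  rw [Nat.le_div_iff_mul_le hA] at h1
  rw [Nat.div_lt_iff_lt_mul hA] at h2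
  refine ⟨N / 2 ^ j, j, ?_, ?_, hj, Nat.div_mul_le_self _ _,
    (Nat.div_lt_iff_lt_mul hp).1 (Nat.lt_succ_self _)⟩
  · rw [Nat.le_div_iff_mul_le hp, mul_comm]
    exact h1
  · rw [Nat.div_lt_iff_lt_mul hp]
    calc N < 2 ^ (j + 1) * A := h2
      _ = 2 * A * 2 ^ j := by ring

/-- If a Lipschitz-in-time sequence has lacunary limsups `< lam` along `K * 2 ^ j` for all
`A ≤ K < 2 * A`, then its full limsup is `< lam + C₀ * t` as soon as `1 ≤ A * t`. -/
theorem limsup_norm_lt_of_lacunary {E : Type*} [SeminormedAddCommGroup E] {C₀ t lam : ℝ}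
    (hC₀ : 0 ≤ C₀) {u : ℕ → E} (hbdd : ∀ N, ‖u N‖ ≤ 1)
    (hlip : ∀ M N : ℕ, (N : ℝ) / 2 ≤ (M : ℝ) → M ≤ N →
      ‖u N - u M‖ ≤ C₀ * ((N : ℝ) - (M : ℝ)) / N)
    {A : ℕ} (hA : 0 < A) (hAt : 1 ≤ A * t)
    (h : ∀ K ∈ Finset.Ico A (2 * A), limsup (fun j : ℕ => ‖u (K * 2 ^ j)‖) atTop < lam) :
    limsup (fun N : ℕ => ‖u N‖) atTop < lam + C₀ * t := by
  have hne : (Finset.Ico A (2 * A)).Nonempty := ⟨A, by simp; omega⟩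
  obtain ⟨b, hb, hblam⟩ := exists_between ((Finset.sup'_lt_iff hne).2 h)
  rw [Finset.sup'_lt_iff] at hb
  have hev : ∀ᶠ j in atTop, ∀ K ∈ Finset.Ico A (2 * A), ‖u (K * 2 ^ j)‖ < b := by
    rw [Filter.eventually_all_finset]
    exact fun K hK => eventually_lt_of_limsup_lt (hb K hK)
      (isBoundedUnder_of ⟨1, fun j => hbdd _⟩)
  obtain ⟨J, hJ⟩ := eventually_atTop.1 hev
  refine lt_of_le_of_lt (b := b + C₀ * t) ?_ (by linarith)
  refine limsup_le_of_le
    (isBoundedUnder_of ⟨0, fun N => norm_nonneg _⟩ : IsBoundedUnder (· ≥ ·) _ _).isCoboundedUnder_le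
    ?_
  filter_upwards [eventually_ge_atTop (A * 2 ^ J)] with N hN
  obtain ⟨K, j, hAK, hKA, hj, hKN, hNK⟩ := exists_mul_two_pow_le_lt hA hN
  have hu := hJ j hj K (Finset.mem_Ico.2 ⟨hAK, hKA⟩)
  have hp : 1 ≤ 2 ^ j := Nat.one_le_two_pow
  have hK1 : 1 * 2 ^ j ≤ K * 2 ^ j := Nat.mul_le_mul_right _ (by omega)
  have hAp : A * 2 ^ j ≤ N := (Nat.mul_le_mul_right _ hAK).trans hKN
  rw [add_mul] at hNK
  generalize K * 2 ^ j = M at *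
  have hMN : (N : ℝ) ≤ 2 * M := by norm_cast; omega
  have hsub : (N : ℝ) - M ≤ 2 ^ j := by
    rw [sub_le_iff_le_add]; norm_cast; omega
  have hAp' : (A : ℝ) * 2 ^ j ≤ N := by exact_mod_cast hAp
  have hNpos : (0 : ℝ) < N := by norm_cast; omega
  have ht : 0 < t := by
    by_contra hneg
    have : (A : ℝ) * t ≤ 0 := mul_nonpos_of_nonneg_of_nonpos (by positivity) (by linarith)
    linarith
  have hgap : (N : ℝ) - M ≤ t * N := by
    have h1 : (1 : ℝ) * 2 ^ j ≤ A * t * 2 ^ j := by gcongr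
    have h2 : t * (A * 2 ^ j) ≤ t * N := by gcongr
    linarith
  have hdist : ‖u N - u M‖ ≤ C₀ * t := by
    refine (hlip M N (by linarith) hKN).trans ?_
    rw [div_le_iff₀ hNpos, mul_assoc]
    gcongr
  have := norm_le_norm_add_norm_sub' (u N) (u M)
  linarith

/-- **Lacunary reduction.** Let `(f_N)` be `1`-bounded measurable functions on a measure
space which are Lipschitz in the time parameter: `|f_N − f_M| ≤ C₀ (N−M)/N` for
`N/2 ≤ M ≤ N`. If, for every integer `K` with `10/t ≤ K ≤ 200/t`, the set where the limsup
of `|f_{K·2^j}|` along the lacunary subsequence is `≥ λ` has measure at most `ε₁`, then the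
set where the limsup of the full sequence `|f_N|` is `≥ λ + C₀ t` has measure at most
`200 t⁻¹ ε₁`. -/
theorem lacunary_reduction
    {X : Type*} [MeasurableSpace X] (μ : Measure X)
    (C₀ : ℝ) (hC₀ : 0 ≤ C₀) (t : ℝ) (ht0 : 0 < t) (ht1 : t ≤ 1 / 100)
    (lam : ℝ) (hlam : 0 ≤ lam)
    (f : ℕ → X → ℂ) (hmeas : ∀ N, Measurable (f N))
    (hbdd : ∀ N x, ‖f N x‖ ≤ 1)
    (hlip : ∀ x : X, ∀ M N : ℕ, (N : ℝ) / 2 ≤ (M : ℝ) → M ≤ N →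
      ‖f N x - f M x‖ ≤ C₀ * ((N : ℝ) - (M : ℝ)) / N)
    (ε₁ : ℝ≥0∞)
    (hsub : ∀ K : ℕ, 10 / t ≤ (K : ℝ) → (K : ℝ) ≤ 200 / t →
      μ {x | lam ≤ limsup (fun j : ℕ => ‖f (K * 2 ^ j) x‖) atTop} ≤ ε₁) :
    μ {x | lam + C₀ * t ≤ limsup (fun N : ℕ => ‖f N x‖) atTop} ≤
      ENNReal.ofReal (200 * t⁻¹) * ε₁ := by
  obtain ⟨A, hA⟩ : ∃ A, A = ⌈10 / t⌉₊ := ⟨_, rfl⟩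
  have h10 : 10 / t ≤ A := hA ▸ Nat.le_ceil _
  have hA_lt : (A : ℝ) < 10 / t + 1 := hA ▸ Nat.ceil_lt_add_one (by positivity)
  have hA_pos : 0 < A := by
    have : (0 : ℝ) < A := lt_of_lt_of_le (by positivity) h10
    exact_mod_cast this
  have hAt : 1 ≤ A * t := by
    rw [div_le_iff₀ ht0] at h10
    linarith
  have hinv : 100 ≤ t⁻¹ := by
    rw [le_inv_comm₀ (by norm_num) ht0]
    linarith
  rw [div_eq_mul_inv] at hA_lt
  have hcover : {x | lam + C₀ * t ≤ limsup (fun N : ℕ => ‖f N x‖) atTop} ⊆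
      ⋃ K ∈ Finset.Ico A (2 * A),
        {x | lam ≤ limsup (fun j : ℕ => ‖f (K * 2 ^ j) x‖) atTop} := by
    intro x hx
    by_contra hcon
    simp only [Set.mem_iUnion, Set.mem_ofPred_eq, exists_prop, not_exists, not_and, not_le] at hcon
    exact (limsup_norm_lt_of_lacunary hC₀ (fun N => hbdd N x) (hlip x) hA_pos hAt hcon).not_ge hx
  calc _ ≤ μ (⋃ K ∈ Finset.Ico A (2 * A),
        {x | lam ≤ limsup (fun j : ℕ => ‖f (K * 2 ^ j) x‖) atTop}) := measure_mono hcover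
    _ ≤ ∑ K ∈ Finset.Ico A (2 * A),
        μ {x | lam ≤ limsup (fun j : ℕ => ‖f (K * 2 ^ j) x‖) atTop} :=
      measure_biUnion_finset_le _ _
    _ ≤ ∑ _K ∈ Finset.Ico A (2 * A), ε₁ := by
      refine Finset.sum_le_sum fun K hK => hsub K ?_ ?_
      · exact h10.trans (by exact_mod_cast (Finset.mem_Ico.1 hK).1)
      · have : (K : ℝ) ≤ 2 * A := by exact_mod_cast (Finset.mem_Ico.1 hK).2.le
        rw [div_eq_mul_inv]
        linarith
    _ = (A : ℝ≥0∞) * ε₁ := by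
      rw [Finset.sum_const, Nat.card_Ico, nsmul_eq_mul, two_mul, Nat.add_sub_cancel]
    _ ≤ ENNReal.ofReal (200 * t⁻¹) * ε₁ := by
      gcongr
      rw [← ENNReal.ofReal_natCast]
      exact ENNReal.ofReal_le_ofReal (by linarith)
end

section
/- There is an absolute constant C such that the following holds. Let N ≥ 1, let I ⊂ ℤ be an interval with |I| = N, and let J := [−N, 2N] ∩ ℤ. Let φ : ℤ → ℂ satisfy |φ(n)| ≤ N^{−1}·1_I(n) for all n, let f : ℤ → ℂ satisfy |f| ≤ 1, and let g, w : ℤ → ℂ. Then ∑_{x ∈ I} |∑_{n ∈ ℤ} φ(n)·f(2x−n)·w(n−x)·g(n)|² ≤ C · ‖w‖_{U³(J)}² · ∑_{n ∈ I} |g(n)|². -/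
/-- The normalized Gowers norm `‖f‖_{U^s([a,b])}`. -/
noncomputable def gowersNormIcc (s : ℕ) (a b : ℤ) (f : ℤ → ℂ) : ℝ :=
  gowersNorm s (intervalCutoff a b f) / gowersNorm s (intervalCutoff a b (fun _ => 1))

/-- Two finite sums agree when their nonzero terms correspond under mutually inverse maps. -/
lemma Finset.sum_eq_of_ne_zero_inverse {α β M : Type*} [AddCommMonoid M]
    {s : Finset α} {t : Finset β} {F : α → M} {G : β → M} (i : α → β) (j : β → α)
    (hi : ∀ a ∈ s, F a ≠ 0 → i a ∈ t) (hj : ∀ b ∈ t, G b ≠ 0 → j b ∈ s)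
    (hji : ∀ a, j (i a) = a) (hij : ∀ b, i (j b) = b)
    (h : ∀ a ∈ s, F a = G (i a)) :
    ∑ a ∈ s, F a = ∑ b ∈ t, G b := by
  classical
  rw [← Finset.sum_filter_ne_zero s, ← Finset.sum_filter_ne_zero t]
  refine Finset.sum_nbij' i j ?_ ?_ (fun a _ => hji a) (fun b _ => hij b) ?_
  · intro a ha
    rw [Finset.mem_filter] at ha ⊢
    exact ⟨hi a ha.1 ha.2, h a ha.1 ▸ ha.2⟩
  · intro b hb
    rw [Finset.mem_filter] at hb ⊢
    exact ⟨hj b hb.1 hb.2, by rw [h _ (hj b hb.1 hb.2), hij]; exact hb.2⟩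
  · exact fun a ha => h a (Finset.mem_filter.1 ha).1

open ComplexConjugate in
/-- The squared modulus of a finite sum, expanded as a double sum. -/
lemma Complex.normSq_sum_eq_sum_sum {ι : Type*} (s : Finset ι) (z : ι → ℂ) :
    ((‖∑ i ∈ s, z i‖ ^ 2 : ℝ) : ℂ) = ∑ i ∈ s, ∑ j ∈ s, z i * conj (z j) := by
  rw [Complex.ofReal_pow, ← Complex.mul_conj', map_sum, Finset.sum_mul_sum]

open ComplexConjugate in
/-- The operator norm of a kernel is at most the Hilbert–Schmidt norm of `T* T`. -/
lemma sq_sum_norm_sq_kernel_le {ι κ : Type*} (s : Finset ι) (t : Finset κ)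
    (K : ι → κ → ℂ) (g : κ → ℂ) :
    (∑ x ∈ s, ‖∑ n ∈ t, K x n * g n‖ ^ 2) ^ 2 ≤
      (∑ n ∈ t, ‖g n‖ ^ 2) ^ 2 *
        ∑ n ∈ t, ∑ n' ∈ t, ‖∑ x ∈ s, K x n * conj (K x n')‖ ^ 2 := by
  have hexp : ((∑ x ∈ s, ‖∑ n ∈ t, K x n * g n‖ ^ 2 : ℝ) : ℂ) =
      ∑ p ∈ t ×ˢ t, (g p.1 * conj (g p.2)) * ∑ x ∈ s, K x p.1 * conj (K x p.2) := by
    rw [Complex.ofReal_sum, Finset.sum_product]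
    simp_rw [Complex.normSq_sum_eq_sum_sum, Finset.mul_sum]
    rw [Finset.sum_comm]
    refine Finset.sum_congr rfl fun n _ => ?_
    rw [Finset.sum_comm]
    refine Finset.sum_congr rfl fun n' _ => Finset.sum_congr rfl fun x _ => ?_
    rw [map_mul]
    ring
  have hnn : 0 ≤ ∑ x ∈ s, ‖∑ n ∈ t, K x n * g n‖ ^ 2 :=
    Finset.sum_nonneg fun _ _ => sq_nonneg _
  have hle : ∑ x ∈ s, ‖∑ n ∈ t, K x n * g n‖ ^ 2 ≤
      ∑ p ∈ t ×ˢ t, (‖g p.1‖ * ‖g p.2‖) * ‖∑ x ∈ s, K x p.1 * conj (K x p.2)‖ := by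
    rw [← Complex.norm_of_nonneg hnn, hexp]
    refine (norm_sum_le _ _).trans_eq (Finset.sum_congr rfl fun p _ => ?_)
    rw [norm_mul, norm_mul, RCLike.norm_conj]
  refine (pow_le_pow_left₀ hnn hle 2).trans ((Finset.sum_mul_sq_le_sq_mul_sq _ _ _).trans_eq ?_)
  rw [← Finset.sum_product' (f := fun n n' => ‖∑ x ∈ s, K x n * conj (K x n')‖ ^ 2)]
  congr 1
  simp_rw [mul_pow]
  rw [sq, Finset.sum_mul_sum, Finset.sum_product]

open ComplexConjugate in
/-- The second multiplicative derivative `Δ_h Δ_k v`. -/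
noncomputable def secondDiff (v : ℤ → ℂ) (h k a : ℤ) : ℂ :=
  v a * conj (v (a + h)) * conj (v (a + k) * conj (v (a + k + h)))

lemma ne_zero_of_secondDiff_ne_zero {v : ℤ → ℂ} {h k a : ℤ} (H : secondDiff v h k a ≠ 0) :
    v a ≠ 0 ∧ v (a + h) ≠ 0 ∧ v (a + k) ≠ 0 ∧ v (a + k + h) ≠ 0 := by
  unfold secondDiff at H
  refine ⟨?_, ?_, ?_, ?_⟩ <;> intro h0 <;> simp [h0] at H

open ComplexConjugate in
lemma secondDiff_mul_conj (v : ℤ → ℂ) (h k l a : ℤ) :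
    secondDiff v h k a * conj (secondDiff v h k (a + l)) =
      secondDiff v k l a * conj (secondDiff v k l (a + h)) := by
  unfold secondDiff
  rw [show a + l + h = a + h + l by ring, show a + l + k = a + k + l by ring,
    show a + h + k = a + k + h by ring, show a + h + l + k = a + k + l + h by ring]
  simp only [map_mul, Complex.conj_conj]
  ring

open ComplexConjugate in
lemma gowersIterDiff_three_s15 (v : ℤ → ℂ) (k l h a : ℤ) :
    gowersIterDiff 3 v ![k, l, h] a =
      secondDiff v k l a * conj (secondDiff v k l (a + h)) := by
  simp [gowersIterDiff, gowersDiff, secondDiff]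

/-- The eighth power of the `U³` norm of a function on `[-N, 2N]`, as a sum of squares. -/
noncomputable def boxSquares (N : ℕ) (v : ℤ → ℂ) : ℝ :=
  ∑ k ∈ Finset.Icc (-(3 * N : ℤ)) (3 * N), ∑ l ∈ Finset.Icc (-(3 * N : ℤ)) (3 * N),
    ‖∑ a ∈ Finset.Icc (-(N : ℤ)) (2 * N), secondDiff v k l a‖ ^ 2

lemma boxSquares_nonneg (N : ℕ) (v : ℤ → ℂ) : 0 ≤ boxSquares N v :=
  Finset.sum_nonneg fun _ _ => Finset.sum_nonneg fun _ _ => sq_nonneg _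

/-- Cube parameters `(k, l, a, b)`, with third difference `b - a`. -/
def cubeEquiv : ℤ × ℤ × ℤ × ℤ ≃ (Fin 3 → ℤ) × ℤ where
  toFun p := (![p.1, p.2.1, p.2.2.2 - p.2.2.1], p.2.2.1)
  invFun q := (q.1 0, q.1 1, q.2, q.2 + q.1 2)
  left_inv p := by simp
  right_inv q := by
    refine Prod.ext ?_ rfl
    funext i
    fin_cases i <;> simp

open ComplexConjugate in
lemma gowersSum_three_eq_boxSquares {N : ℕ} {v : ℤ → ℂ}
    (hv : ∀ a, v a ≠ 0 → -(N : ℤ) ≤ a ∧ a ≤ 2 * N) :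
    gowersSum 3 v = boxSquares N v := by
  have hterm : ∀ p : ℤ × ℤ × ℤ × ℤ,
      gowersIterDiff 3 v (cubeEquiv p).1 (cubeEquiv p).2 =
        secondDiff v p.1 p.2.1 p.2.2.1 * conj (secondDiff v p.1 p.2.1 p.2.2.2) := by
    intro p
    rw [cubeEquiv, Equiv.coe_fn_mk, gowersIterDiff_three_s15, add_sub_cancel]
  unfold gowersSum
  rw [← cubeEquiv.tsum_eq]
  simp_rw [hterm]
  rw [tsum_eq_sum (s := Finset.Icc (-(3 * N : ℤ)) (3 * N) ×ˢ Finset.Icc (-(3 * N : ℤ)) (3 * N) ×ˢ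
    Finset.Icc (-(N : ℤ)) (2 * N) ×ˢ Finset.Icc (-(N : ℤ)) (2 * N))]
  · simp_rw [Finset.sum_product, boxSquares, Complex.ofReal_sum, Complex.normSq_sum_eq_sum_sum]
  · rintro ⟨k, l, a, b⟩ hp
    by_contra hne
    obtain ⟨h1, h2⟩ := mul_ne_zero_iff.1 hne
    rw [Ne, map_eq_zero] at h2
    have ha := ne_zero_of_secondDiff_ne_zero h1
    have hb := ne_zero_of_secondDiff_ne_zero h2
    have a0 := hv _ ha.1
    have a1 := hv _ ha.2.1
    have a2 := hv _ ha.2.2.1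
    have b0 := hv _ hb.1
    apply hp
    simp only [Finset.mem_product, Finset.mem_Icc]
    dsimp only at *
    omega

lemma gowersNorm_three_pow {N : ℕ} {v : ℤ → ℂ}
    (hv : ∀ a, v a ≠ 0 → -(N : ℤ) ≤ a ∧ a ≤ 2 * N) :
    0 ≤ gowersNorm 3 v ∧ gowersNorm 3 v ^ 8 = boxSquares N v := by
  have h0 := boxSquares_nonneg N v
  rw [gowersNorm, gowersSum_three_eq_boxSquares hv, Complex.ofReal_re]
  refine ⟨Real.rpow_nonneg h0 _, ?_⟩
  rw [← Real.rpow_natCast, ← Real.rpow_mul h0]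
  norm_num

lemma intervalCutoff_support_s15 {a b : ℤ} {w : ℤ → ℂ} {n : ℤ} (h : intervalCutoff a b w n ≠ 0) :
    a ≤ n ∧ n ≤ b := by
  by_contra hn
  exact h (if_neg hn)

lemma boxSquares_one_bounds {N : ℕ} (hN : 1 ≤ N) :
    0 < boxSquares N (intervalCutoff (-(N : ℤ)) (2 * N) fun _ => 1) ∧
      boxSquares N (intervalCutoff (-(N : ℤ)) (2 * N) fun _ => 1) ≤ 784 * (N : ℝ) ^ 4 := by
  set v : ℤ → ℂ := intervalCutoff (-(N : ℤ)) (2 * N) fun _ => 1 with hv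
  have hN' : (1 : ℝ) ≤ N := by exact_mod_cast hN
  have hcJ : (((Finset.Icc (-(N : ℤ)) (2 * N)).card : ℕ) : ℝ) = 3 * N + 1 := by
    rw [Int.card_Icc, show (2 * (N : ℤ) + 1 - -N).toNat = 3 * N + 1 by omega]
    push_cast; ring
  have hcD : (((Finset.Icc (-(3 * N : ℤ)) (3 * N)).card : ℕ) : ℝ) = 6 * N + 1 := by
    rw [Int.card_Icc, show (3 * (N : ℤ) + 1 - -(3 * N)).toNat = 6 * N + 1 by omega]
    push_cast; ring
  have hbd : ∀ n, ‖v n‖ ≤ 1 := by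
    intro n
    rw [hv, intervalCutoff]
    split_ifs <;> simp
  constructor
  · have h0 : (0 : ℤ) ∈ Finset.Icc (-(3 * N : ℤ)) (3 * N) := by
      rw [Finset.mem_Icc]; omega
    have hsum : ∑ a ∈ Finset.Icc (-(N : ℤ)) (2 * N), secondDiff v 0 0 a = (3 * N + 1 : ℝ) := by
      rw [← hcJ, Finset.sum_congr rfl (g := fun _ => (1 : ℂ))]
      · simp
      · intro a ha
        rw [Finset.mem_Icc] at ha
        have : v a = 1 := by rw [hv, intervalCutoff, if_pos ha]
        simp [secondDiff, this]
    have hpos : 0 < ‖∑ a ∈ Finset.Icc (-(N : ℤ)) (2 * N), secondDiff v 0 0 a‖ ^ 2 := by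
      rw [hsum, Complex.norm_of_nonneg (by positivity)]
      positivity
    refine hpos.trans_le ?_
    refine (Finset.single_le_sum (f := fun l => ‖∑ a ∈ Finset.Icc (-(N : ℤ)) (2 * N),
      secondDiff v 0 l a‖ ^ 2) (fun _ _ => sq_nonneg _) h0).trans ?_
    exact Finset.single_le_sum (f := fun k => ∑ l ∈ Finset.Icc (-(3 * N : ℤ)) (3 * N),
      ‖∑ a ∈ Finset.Icc (-(N : ℤ)) (2 * N), secondDiff v k l a‖ ^ 2)
      (fun _ _ => Finset.sum_nonneg fun _ _ => sq_nonneg _) h0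
  · have hterm : ∀ k l, ‖∑ a ∈ Finset.Icc (-(N : ℤ)) (2 * N), secondDiff v k l a‖ ^ 2 ≤
        (3 * N + 1 : ℝ) ^ 2 := by
      intro k l
      refine pow_le_pow_left₀ (norm_nonneg _) ?_ 2
      refine (norm_sum_le_of_le (n := fun _ => (1 : ℝ)) _ fun a _ => ?_).trans_eq ?_
      · simp only [secondDiff, norm_mul, RCLike.norm_conj]
        calc _ ≤ (1 : ℝ) * 1 * (1 * 1) := by gcongr <;> apply hbd
          _ = 1 := by norm_num
      · rw [Finset.sum_const, nsmul_eq_mul, hcJ, mul_one]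
    calc _ ≤ ∑ k ∈ Finset.Icc (-(3 * N : ℤ)) (3 * N), ∑ l ∈ Finset.Icc (-(3 * N : ℤ)) (3 * N),
          (3 * N + 1 : ℝ) ^ 2 :=
          Finset.sum_le_sum fun k _ => Finset.sum_le_sum fun l _ => hterm k l
      _ = (6 * N + 1 : ℝ) ^ 2 * (3 * N + 1 : ℝ) ^ 2 := by
          simp only [Finset.sum_const, nsmul_eq_mul, hcD]; ring
      _ ≤ (7 * N : ℝ) ^ 2 * (4 * N : ℝ) ^ 2 := by gcongr <;> linarith
      _ = 784 * (N : ℝ) ^ 4 := by ring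

/-- The product `1_I(x) 1_I(x - k)` for an interval `I` of length `N` starting at `x₀`. -/
noncomputable def pairCutoff (x₀ : ℤ) (N : ℕ) (k x : ℤ) : ℝ :=
  if x ∈ Finset.Icc x₀ (x₀ + N - 1) ∧ x - k ∈ Finset.Icc x₀ (x₀ + N - 1) then 1 else 0

lemma pairCutoff_nonneg (x₀ : ℤ) (N : ℕ) (k x : ℤ) : 0 ≤ pairCutoff x₀ N k x := by
  unfold pairCutoff; split_ifs <;> norm_num

lemma pairCutoff_le_one (x₀ : ℤ) (N : ℕ) (k x : ℤ) : pairCutoff x₀ N k x ≤ 1 := by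
  unfold pairCutoff; split_ifs <;> norm_num

lemma mem_of_pairCutoff_ne_zero {x₀ : ℤ} {N : ℕ} {k x : ℤ} (h : pairCutoff x₀ N k x ≠ 0) :
    (x₀ ≤ x ∧ x ≤ x₀ + N - 1) ∧ x₀ ≤ x - k ∧ x - k ≤ x₀ + N - 1 := by
  unfold pairCutoff at h
  by_contra hn
  simp only [Finset.mem_Icc] at h
  exact h (if_neg hn)

/-- The localized averages of `Δ_h Δ_k v`. -/
noncomputable def localAverage (x₀ : ℤ) (N : ℕ) (v : ℤ → ℂ) (h k m : ℤ) : ℂ :=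
  ∑ a ∈ Finset.Icc (-(N : ℤ)) (2 * N), pairCutoff x₀ N k (m + a) * secondDiff v h k a

/-- Number of `y` with `y` and `y + l` both selected by the pair cutoff. -/
noncomputable def pairCorrelation (x₀ : ℤ) (N : ℕ) (k l : ℤ) : ℝ :=
  ∑ y ∈ Finset.Icc x₀ (x₀ + N - 1), pairCutoff x₀ N k y * pairCutoff x₀ N k (y + l)

lemma pairCorrelation_nonneg (x₀ : ℤ) (N : ℕ) (k l : ℤ) : 0 ≤ pairCorrelation x₀ N k l :=
  Finset.sum_nonneg fun _ _ => mul_nonneg (pairCutoff_nonneg ..) (pairCutoff_nonneg ..)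

lemma pairCorrelation_le (x₀ : ℤ) (N : ℕ) (k l : ℤ) : pairCorrelation x₀ N k l ≤ N := by
  calc _ ≤ ∑ y ∈ Finset.Icc x₀ (x₀ + N - 1), (1 : ℝ) :=
        Finset.sum_le_sum fun y _ => mul_le_one₀ (pairCutoff_le_one ..) (pairCutoff_nonneg ..)
          (pairCutoff_le_one ..)
    _ = N := by simp

lemma sum_pairCutoff_mul {x₀ : ℤ} {N : ℕ} {k a b : ℤ} (ha : -(N : ℤ) ≤ a ∧ a ≤ 2 * N) :
    ∑ m ∈ Finset.Icc (x₀ - 2 * N) (x₀ + 2 * N - 1),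
      pairCutoff x₀ N k (m + a) * pairCutoff x₀ N k (m + b) = pairCorrelation x₀ N k (b - a) := by
  unfold pairCorrelation
  refine Finset.sum_eq_of_ne_zero_inverse (fun m => m + a) (fun y => y - a) ?_ ?_ (by simp)
    (by simp) ?_
  · intro m _ h
    have := mem_of_pairCutoff_ne_zero (left_ne_zero_of_mul h)
    rw [Finset.mem_Icc]
    exact this.1
  · intro y hy _
    rw [Finset.mem_Icc] at hy ⊢
    omega
  · intro m _
    rw [show m + a + (b - a) = m + b by ring]

open ComplexConjugate in
lemma sum_norm_sq_localAverage_le {x₀ : ℤ} {N : ℕ} {v : ℤ → ℂ}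
    (hv : ∀ a, v a ≠ 0 → -(N : ℤ) ≤ a ∧ a ≤ 2 * N) :
    ∑ k ∈ Finset.Icc (-(3 * N : ℤ)) (3 * N), ∑ h ∈ Finset.Icc (-(3 * N : ℤ)) (3 * N),
      ∑ m ∈ Finset.Icc (x₀ - 2 * N) (x₀ + 2 * N - 1), ‖localAverage x₀ N v h k m‖ ^ 2 ≤
    N * boxSquares N v := by
  set D := Finset.Icc (-(3 * N : ℤ)) (3 * N) with hD
  set J := Finset.Icc (-(N : ℤ)) (2 * N) with hJ
  have key : ∀ k, ∑ h ∈ D, ∑ m ∈ Finset.Icc (x₀ - 2 * N) (x₀ + 2 * N - 1),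
      ‖localAverage x₀ N v h k m‖ ^ 2 =
      ∑ l ∈ D, pairCorrelation x₀ N k l * ‖∑ a ∈ J, secondDiff v k l a‖ ^ 2 := by
    intro k
    have h1 : ∀ h, ((∑ m ∈ Finset.Icc (x₀ - 2 * N) (x₀ + 2 * N - 1),
        ‖localAverage x₀ N v h k m‖ ^ 2 : ℝ) : ℂ) = ∑ a ∈ J, ∑ b ∈ J,
          (pairCorrelation x₀ N k (b - a) : ℂ) *
            (secondDiff v h k a * conj (secondDiff v h k b)) := by
      intro h
      simp_rw [Complex.ofReal_sum, localAverage, Complex.normSq_sum_eq_sum_sum]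
      rw [Finset.sum_comm]
      refine Finset.sum_congr rfl fun a ha => ?_
      rw [Finset.sum_comm]
      refine Finset.sum_congr rfl fun b _ => ?_
      rw [hJ, Finset.mem_Icc] at ha
      rw [← sum_pairCutoff_mul ha, Complex.ofReal_sum, Finset.sum_mul]
      refine Finset.sum_congr rfl fun m _ => ?_
      rw [map_mul, Complex.conj_ofReal, Complex.ofReal_mul]
      ring
    apply Complex.ofReal_injective
    rw [Complex.ofReal_sum]
    simp_rw [h1, Complex.ofReal_sum, Complex.ofReal_mul, Complex.normSq_sum_eq_sum_sum,
      Finset.mul_sum]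
    have h2 : ∀ F : ℤ → ℤ → ℤ → ℂ, ∑ h ∈ D, ∑ a ∈ J, ∑ b ∈ J, F h a b =
        ∑ p ∈ D ×ˢ J ×ˢ J, F p.1 p.2.1 p.2.2 := by
      intro F
      simp_rw [Finset.sum_product]
    rw [h2, h2]
    refine Finset.sum_eq_of_ne_zero_inverse
      (fun p => (p.2.2 - p.2.1, p.2.1, p.2.1 + p.1)) (fun p => (p.2.2 - p.2.1, p.2.1, p.2.1 + p.1))
      ?_ ?_ (by simp) (by simp) ?_
    · rintro ⟨h, a, b⟩ hp hne
      simp only [Finset.mem_product, Finset.mem_Icc, hD, hJ] at hp ⊢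
      have h3 := right_ne_zero_of_mul hne
      have a1 := hv _ (ne_zero_of_secondDiff_ne_zero (left_ne_zero_of_mul h3)).2.1
      dsimp only at *
      omega
    · rintro ⟨l, a, c⟩ hp hne
      simp only [Finset.mem_product, Finset.mem_Icc, hD, hJ] at hp ⊢
      have h3 := right_ne_zero_of_mul hne
      have a1 := hv _ (ne_zero_of_secondDiff_ne_zero (left_ne_zero_of_mul h3)).2.2.1
      dsimp only at *
      omega
    · rintro ⟨h, a, b⟩ _
      dsimp only
      rw [← secondDiff_mul_conj, add_sub_cancel]
  unfold boxSquares
  rw [Finset.mul_sum]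
  refine Finset.sum_le_sum fun k _ => ?_
  rw [key, Finset.mul_sum]
  exact Finset.sum_le_sum fun l _ =>
    mul_le_mul_of_nonneg_right (pairCorrelation_le ..) (sq_nonneg _)

lemma sq_sum_norm_localAverage_le {x₀ : ℤ} {N : ℕ} (hN : 1 ≤ N) {v : ℤ → ℂ}
    (hv : ∀ a, v a ≠ 0 → -(N : ℤ) ≤ a ∧ a ≤ 2 * N) :
    (∑ k ∈ Finset.Icc (-(3 * N : ℤ)) (3 * N), ∑ h ∈ Finset.Icc (-(3 * N : ℤ)) (3 * N),
      ∑ m ∈ Finset.Icc (x₀ - 2 * N) (x₀ + 2 * N - 1), ‖localAverage x₀ N v h k m‖) ^ 2 ≤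
    196 * (N : ℝ) ^ 4 * boxSquares N v := by
  have hN' : (1 : ℝ) ≤ N := by exact_mod_cast hN
  have hcD : (((Finset.Icc (-(3 * N : ℤ)) (3 * N)).card : ℕ) : ℝ) = 6 * N + 1 := by
    rw [Int.card_Icc, show (3 * (N : ℤ) + 1 - -(3 * N)).toNat = 6 * N + 1 by omega]
    push_cast; ring
  have hcM : (((Finset.Icc (x₀ - 2 * N) (x₀ + 2 * N - 1)).card : ℕ) : ℝ) = 4 * N := by
    rw [Int.card_Icc, show (x₀ + 2 * N - 1 + 1 - (x₀ - 2 * N)).toNat = 4 * N by omega]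
    push_cast; ring
  have h2 := sum_norm_sq_localAverage_le (x₀ := x₀) hv
  simp_rw [← Finset.sum_product'] at h2 ⊢
  refine sq_sum_le_card_mul_sum_sq.trans ?_
  rw [Finset.card_product, Finset.card_product]
  push_cast
  rw [hcD, hcM]
  have h3 : (6 * N + 1 : ℝ) ≤ 7 * N := by linarith
  have h4 := boxSquares_nonneg N v
  have h5 : (6 * N + 1 : ℝ) * ((6 * N + 1) * (4 * N)) ≤ 7 * N * (7 * N * (4 * N)) := by gcongr
  calc _ ≤ (7 * N * (7 * N * (4 * N)) : ℝ) * (N * boxSquares N v) :=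
        mul_le_mul h5 h2 (Finset.sum_nonneg fun _ _ => sq_nonneg _) (by positivity)
    _ = _ := by ring

/-- The kernel with all bounded weights removed. -/
noncomputable def dilatedKernel (f v : ℤ → ℂ) (x n : ℤ) : ℂ := f (2 * x - n) * v (n - x)

open ComplexConjugate in
lemma sum_norm_sq_dilatedKernel_le {x₀ : ℤ} {N : ℕ} {f v : ℤ → ℂ} (hf : ∀ n, ‖f n‖ ≤ 1)
    (hv : ∀ a, v a ≠ 0 → -(N : ℤ) ≤ a ∧ a ≤ 2 * N) :
    ∑ n ∈ Finset.Icc x₀ (x₀ + N - 1), ∑ n' ∈ Finset.Icc x₀ (x₀ + N - 1),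
      ‖∑ x ∈ Finset.Icc x₀ (x₀ + N - 1),
        dilatedKernel f v x n * conj (dilatedKernel f v x n')‖ ^ 2 ≤
    ∑ k ∈ Finset.Icc (-(3 * N : ℤ)) (3 * N), ∑ h ∈ Finset.Icc (-(3 * N : ℤ)) (3 * N),
      ∑ m ∈ Finset.Icc (x₀ - 2 * N) (x₀ + 2 * N - 1), ‖localAverage x₀ N v h k m‖ := by
  set I := Finset.Icc x₀ (x₀ + N - 1) with hI
  set D := Finset.Icc (-(3 * N : ℤ)) (3 * N) with hD
  set J := Finset.Icc (-(N : ℤ)) (2 * N) with hJ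
  set M := Finset.Icc (x₀ - 2 * N) (x₀ + 2 * N - 1) with hM
  set E := Finset.Icc (x₀ - N) (x₀ + 3 * N) with hE
  set T : ℤ → ℤ → ℝ := fun n h => ‖∑ x ∈ I,
    dilatedKernel f v x n * conj (dilatedKernel f v x (n + h))‖ ^ 2 with hT
  have hT0 : ∀ n h, 0 ≤ T n h := fun _ _ => sq_nonneg _
  have hshift : ∀ n ∈ I, ∑ n' ∈ I, ‖∑ x ∈ I,
      dilatedKernel f v x n * conj (dilatedKernel f v x n')‖ ^ 2 ≤ ∑ h ∈ D, T n h := by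
    intro n hn
    calc _ = ∑ h ∈ I.image (fun n' => n' - n), T n h := by
          rw [Finset.sum_image (fun a _ b _ hab => by simpa using hab)]
          simp only [hT, add_sub_cancel]
      _ ≤ _ := by
          refine Finset.sum_le_sum_of_subset_of_nonneg ?_ fun _ _ _ => hT0 _ _
          intro h hh
          obtain ⟨n', hn', rfl⟩ := Finset.mem_image.1 hh
          simp only [hI, hD, Finset.mem_Icc] at *
          omega
  have hexp : ((∑ n ∈ E, ∑ h ∈ D, T n h : ℝ) : ℂ) = ∑ k ∈ D, ∑ h ∈ D, ∑ m ∈ M,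
      (f m * conj (f (m - h)) * conj (f (m - 2 * k) * conj (f (m - 2 * k - h)))) *
        localAverage x₀ N v h k m := by
    simp_rw [Complex.ofReal_sum, hT, Complex.normSq_sum_eq_sum_sum, localAverage, Finset.mul_sum]
    have h4 : ∀ (A B C D : Finset ℤ) (F : ℤ → ℤ → ℤ → ℤ → ℂ),
        ∑ a ∈ A, ∑ b ∈ B, ∑ c ∈ C, ∑ d ∈ D, F a b c d =
        ∑ p ∈ A ×ˢ B ×ˢ C ×ˢ D, F p.1 p.2.1 p.2.2.1 p.2.2.2 := by
      intro A B C D F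
      simp_rw [Finset.sum_product]
    rw [h4, h4]
    refine Finset.sum_eq_of_ne_zero_inverse
      (fun p => (p.2.2.1 - p.2.2.2, p.2.1, 2 * p.2.2.1 - p.1, p.1 - p.2.2.1))
      (fun q => (q.2.2.1 + 2 * q.2.2.2, q.2.1, q.2.2.1 + q.2.2.2, q.2.2.1 + q.2.2.2 - q.1))
      ?_ ?_ ?_ ?_ ?_
    · rintro ⟨n, h, x, x'⟩ hp hne
      simp only [Finset.mem_product, Finset.mem_Icc, hE, hD, hI, hM] at hp ⊢
      have h0 := left_ne_zero_of_mul (left_ne_zero_of_mul hne)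
      have h1 := hv _ (right_ne_zero_of_mul h0)
      dsimp only at *
      omega
    · rintro ⟨k, h, m, a⟩ hp hne
      simp only [Finset.mem_product, Finset.mem_Icc, hE, hD, hI, hM] at hp ⊢
      have h0 := left_ne_zero_of_mul (right_ne_zero_of_mul hne)
      have h1 := mem_of_pairCutoff_ne_zero (Complex.ofReal_ne_zero.1 h0)
      dsimp only at *
      omega
    · rintro ⟨n, h, x, x'⟩
      simp only [Prod.mk.injEq]
      refine ⟨?_, trivial, ?_, ?_⟩ <;> ring
    · rintro ⟨k, h, m, a⟩
      simp only [Prod.mk.injEq]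
      refine ⟨?_, trivial, ?_, ?_⟩ <;> ring
    · rintro ⟨n, h, x, x'⟩ hp
      simp only [Finset.mem_product] at hp
      have hcut : pairCutoff x₀ N (x - x') (2 * x - n + (n - x)) = 1 := by
        rw [pairCutoff, show 2 * x - n + (n - x) = x by ring, sub_sub_cancel, if_pos hp.2.2]
      dsimp only
      rw [hcut]
      unfold dilatedKernel secondDiff
      rw [show 2 * x - (n + h) = 2 * x - n - h by ring,
        show 2 * x' - (n + h) = 2 * x' - n - h by ring,
        show 2 * x - n - 2 * (x - x') = 2 * x' - n by ring,
        show n - x + h = n + h - x by ring, show n - x + (x - x') = n - x' by ring,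
        show n - x' + h = n + h - x' by ring]
      simp only [map_mul, Complex.conj_conj, Complex.ofReal_one, one_mul]
      ring
  calc _ ≤ ∑ n ∈ I, ∑ h ∈ D, T n h := Finset.sum_le_sum hshift
    _ ≤ ∑ n ∈ E, ∑ h ∈ D, T n h := by
        refine Finset.sum_le_sum_of_subset_of_nonneg ?_
          fun _ _ _ => Finset.sum_nonneg fun _ _ => hT0 _ _
        intro n hn
        simp only [hI, hE, Finset.mem_Icc] at *
        omega
    _ = ‖((∑ n ∈ E, ∑ h ∈ D, T n h : ℝ) : ℂ)‖ := by
        rw [Complex.norm_of_nonneg (Finset.sum_nonneg fun _ _ => Finset.sum_nonneg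
          fun _ _ => hT0 _ _)]
    _ ≤ _ := by
        rw [hexp]
        refine norm_sum_le_of_le _ fun k _ => norm_sum_le_of_le _ fun h _ =>
          norm_sum_le_of_le _ fun m _ => ?_
        rw [norm_mul]
        refine mul_le_of_le_one_left (norm_nonneg _) ?_
        simp only [norm_mul, RCLike.norm_conj]
        calc _ ≤ (1 : ℝ) * 1 * (1 * 1) := by gcongr <;> apply hf
          _ = 1 := by norm_num

/-- **Single-scale `U³` control of bilinear forms.** There is an absolute constant `C` such
that: if `I = [x₀, x₀+N−1]` is an interval of length `N ≥ 1`, `J = [−N, 2N] ∩ ℤ`,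
`|φ| ≤ N⁻¹ 1_I`, `|f| ≤ 1`, then
`∑_{x ∈ I} |∑_{n ∈ ℤ} φ(n) f(2x−n) w(n−x) g(n)|² ≤ C ‖w‖_{U³(J)}² ∑_{n ∈ I} |g(n)|²`. -/
theorem bilinear_single_scale_U3 :
    ∃ C : ℝ, ∀ N : ℕ, 1 ≤ N → ∀ x₀ : ℤ, ∀ φ f g w : ℤ → ℂ,
    (∀ n : ℤ, ‖φ n‖ ≤ if n ∈ Finset.Icc x₀ (x₀ + (N : ℤ) - 1) then ((N : ℝ))⁻¹ else 0) →
    (∀ n : ℤ, ‖f n‖ ≤ 1) →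
    ∑ x ∈ Finset.Icc x₀ (x₀ + (N : ℤ) - 1),
        ‖∑' n : ℤ, φ n * f (2 * x - n) * w (n - x) * g n‖ ^ 2 ≤
      C * gowersNormIcc 3 (-(N : ℤ)) (2 * (N : ℤ)) w ^ 2 *
        ∑ n ∈ Finset.Icc x₀ (x₀ + (N : ℤ) - 1), ‖g n‖ ^ 2 := by
  refine ⟨20, fun N hN x₀ φ f g w hφ hf => ?_⟩
  have hN' : (0 : ℝ) < N := by exact_mod_cast hN
  set I := Finset.Icc x₀ (x₀ + (N : ℤ) - 1) with hI
  set v : ℤ → ℂ := intervalCutoff (-(N : ℤ)) (2 * N) w with hvdef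
  set u : ℤ → ℂ := intervalCutoff (-(N : ℤ)) (2 * N) fun _ => 1 with hudef
  have hv : ∀ a, v a ≠ 0 → -(N : ℤ) ≤ a ∧ a ≤ 2 * N := fun a => intervalCutoff_support_s15
  have hu : ∀ a, u a ≠ 0 → -(N : ℤ) ≤ a ∧ a ≤ 2 * N := fun a => intervalCutoff_support_s15
  have hφ0 : ∀ n, n ∉ I → φ n = 0 := fun n hn => by simpa [hn] using hφ n
  have hφ1 : ∀ n, ‖φ n‖ ≤ (N : ℝ)⁻¹ := fun n => (hφ n).trans (by
    split_ifs
    · exact le_rfl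
    · positivity)
  have hlhs : ∀ x ∈ I, ∑' n : ℤ, φ n * f (2 * x - n) * w (n - x) * g n =
      ∑ n ∈ I, (φ n * dilatedKernel f v x n) * g n := by
    intro x hx
    rw [tsum_eq_sum (s := I) fun n hn => by simp [hφ0 n hn]]
    refine Finset.sum_congr rfl fun n hn => ?_
    rw [hI, Finset.mem_Icc] at hx hn
    have hvw : v (n - x) = w (n - x) := if_pos (by omega)
    rw [dilatedKernel, hvw]
    ring
  rw [Finset.sum_congr rfl fun x hx => by rw [hlhs x hx]]
  set S := ∑ x ∈ I, ‖∑ n ∈ I, (φ n * dilatedKernel f v x n) * g n‖ ^ 2 with hS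
  set G := ∑ n ∈ I, ‖g n‖ ^ 2 with hG
  set Q := ∑ n ∈ I, ∑ n' ∈ I,
    ‖∑ x ∈ I, dilatedKernel f v x n * (starRingEnd ℂ) (dilatedKernel f v x n')‖ ^ 2 with hQ
  have hS0 : 0 ≤ S := Finset.sum_nonneg fun _ _ => sq_nonneg _
  have hG0 : 0 ≤ G := Finset.sum_nonneg fun _ _ => sq_nonneg _
  have hQ0 : 0 ≤ Q := Finset.sum_nonneg fun _ _ => Finset.sum_nonneg fun _ _ => sq_nonneg _
  have hSQ : S ^ 2 ≤ G ^ 2 * ((N : ℝ)⁻¹ ^ 4 * Q) := by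
    refine (sq_sum_norm_sq_kernel_le I I _ g).trans
      (mul_le_mul_of_nonneg_left ?_ (sq_nonneg _))
    rw [hQ, Finset.mul_sum]
    refine Finset.sum_le_sum fun n _ => ?_
    rw [Finset.mul_sum]
    refine Finset.sum_le_sum fun n' _ => ?_
    have hfac : ∑ x ∈ I, φ n * dilatedKernel f v x n *
        (starRingEnd ℂ) (φ n' * dilatedKernel f v x n') = (φ n * (starRingEnd ℂ) (φ n')) *
        ∑ x ∈ I, dilatedKernel f v x n * (starRingEnd ℂ) (dilatedKernel f v x n') := by
      rw [Finset.mul_sum]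
      refine Finset.sum_congr rfl fun x _ => ?_
      rw [map_mul]
      ring
    rw [hfac, norm_mul, norm_mul, RCLike.norm_conj, mul_pow]
    refine mul_le_mul_of_nonneg_right ?_ (sq_nonneg _)
    calc (‖φ n‖ * ‖φ n'‖) ^ 2 ≤ ((N : ℝ)⁻¹ * (N : ℝ)⁻¹) ^ 2 := by
          gcongr <;> apply hφ1
      _ = (N : ℝ)⁻¹ ^ 4 := by ring
  have hQ2 : Q ^ 2 ≤ 196 * (N : ℝ) ^ 4 * boxSquares N v :=
    (pow_le_pow_left₀ hQ0 (sum_norm_sq_dilatedKernel_le hf hv) 2).trans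
      (sq_sum_norm_localAverage_le hN hv)
  obtain ⟨hA0, hA⟩ := gowersNorm_three_pow hv
  obtain ⟨hB0, hB⟩ := gowersNorm_three_pow hu
  obtain ⟨hu0, hu1⟩ := boxSquares_one_bounds hN
  set A := gowersNorm 3 v
  set B := gowersNorm 3 u
  rw [← hB] at hu0 hu1
  have hnorm : gowersNormIcc 3 (-(N : ℤ)) (2 * N) w = A / B := by
    rw [gowersNormIcc]
  rw [hnorm]
  clear_value S G Q A B
  have hBpos : 0 < B := lt_of_le_of_ne hB0 fun h => by simp [← h] at hu0
  have hQA : Q ≤ 14 * (N : ℝ) ^ 2 * A ^ 4 := by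
    refine (sq_le_sq₀ (by positivity) (by positivity)).1 ?_
    calc Q ^ 2 ≤ _ := hQ2
      _ = _ := by rw [← hA]; ring
  have hBN : B ^ 4 ≤ 28 * (N : ℝ) ^ 2 := by
    refine (sq_le_sq₀ (by positivity) (by positivity)).1 ?_
    calc (B ^ 4) ^ 2 = B ^ 8 := by ring
      _ ≤ _ := hu1
      _ = _ := by ring
  refine (sq_le_sq₀ (by positivity) (by positivity)).1 ?_
  calc S ^ 2 ≤ G ^ 2 * ((N : ℝ)⁻¹ ^ 4 * (14 * (N : ℝ) ^ 2 * A ^ 4)) := by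
        refine hSQ.trans ?_
        gcongr
    _ = G ^ 2 * A ^ 4 * (14 / (N : ℝ) ^ 2) := by field_simp
    _ ≤ G ^ 2 * A ^ 4 * (400 / B ^ 4) := by
        refine mul_le_mul_of_nonneg_left ?_ (by positivity)
        rw [div_le_div_iff₀ (by positivity) (by positivity)]
        nlinarith [sq_nonneg (N : ℝ)]
    _ = (20 * (A / B) ^ 2 * G) ^ 2 := by rw [div_pow]; ring
end
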